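/- arXiv:1010.0590 — 3 statements merged into one kernel-verified Lean document; each statement's English description precedes it below -/
import Mathlib

section
/- Let X be a non-branching Hadamard space. Then any geodesic ray (μ_t)_{t≥0} of W₂(X) admits a unique displacement interpolation, i.e. a unique probability measure μ on the space R(X) of geodesic rays of X such that (e_t)_#μ = μ_t for all t ≥ 0, where e_t(γ) = γ_t. -/
open MeasureTheory Filter Set Topology
open scoped NNReal ENNReal

noncomputable section


/-! ## Geodesics and Hadamard spaces -/

/-- `γ` is a geodesic on the set of parameters `s`, of speed `v`, with respect to the
distance function `d`. -/
def IsGeodesicOnWith {A : Type*} (d : A → A → ℝ) (γ : ℝ → A) (s : Set ℝ) (v : ℝ) : Prop :=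
  ∀ t ∈ s, ∀ t' ∈ s, d (γ t) (γ t') = v * |t - t'|

/-- A metric space is geodesic if any two points are joined by a geodesic. -/
def IsGeodesicSpace (Y : Type*) [MetricSpace Y] : Prop :=
  ∀ x y : Y, ∃ γ : ℝ → Y, γ 0 = x ∧ γ 1 = y ∧
    IsGeodesicOnWith dist γ (Set.Icc (0:ℝ) 1) (dist x y)

/-- Every geodesic segment extends to a complete geodesic (defined on all of `ℝ`). -/
def GeodesicallyComplete (Y : Type*) [MetricSpace Y] : Prop :=
  ∀ (γ : ℝ → Y) (a b v : ℝ), a < b → IsGeodesicOnWith dist γ (Set.Icc a b) v →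
    ∃ g : ℝ → Y, IsGeodesicOnWith dist g Set.univ v ∧ ∀ t ∈ Set.Icc a b, g t = γ t

/-- A Hadamard space: complete, separable, locally compact, geodesic, globally CAT(0).
The CAT(0) comparison inequality is expressed through the explicit formula for the distance
from a vertex to a point of the opposite side in the Euclidean comparison triangle. -/
structure IsHadamard (X : Type*) [MetricSpace X] : Prop where
  complete : CompleteSpace X
  separable : TopologicalSpace.SeparableSpace X
  locallyCompact : LocallyCompactSpace X
  geodesic : IsGeodesicSpace X
  cat0 : ∀ (x y z : X) (γ : ℝ → X), γ 0 = y → γ 1 = z →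
    IsGeodesicOnWith dist γ (Set.Icc (0:ℝ) 1) (dist y z) →
    ∀ t ∈ Set.Icc (0:ℝ) 1,
      dist x (γ t) ^ 2 ≤ (1 - t) * dist x y ^ 2 + t * dist x z ^ 2 - t * (1 - t) * dist y z ^ 2

/-- A space is non-branching if two geodesics coinciding on a nonempty open set of parameters
coincide on their whole common interval of definition. -/
def NonBranching (X : Type*) [MetricSpace X] : Prop :=
  ∀ (γ β : ℝ → X) (I : Set ℝ) (v w : ℝ),
    IsGeodesicOnWith dist γ I v → IsGeodesicOnWith dist β I w →
    (∃ U : Set ℝ, U ⊆ I ∧ IsOpen U ∧ U.Nonempty ∧ ∀ t ∈ U, γ t = β t) →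
    ∀ t ∈ I, γ t = β t

/-! ## The Wasserstein space -/

/-- `π` is a coupling (transport plan) between `μ` and `ν`. -/
def IsCoupling {A B : Type*} [MeasurableSpace A] [MeasurableSpace B]
    (π : Measure (A × B)) (μ : Measure A) (ν : Measure B) : Prop :=
  π.map Prod.fst = μ ∧ π.map Prod.snd = ν

/-- The quadratic Wasserstein space over `Y`: Borel probability measures with finite second
moment. -/
abbrev W2Space (Y : Type*) [MetricSpace Y] [MeasurableSpace Y] : Type _ :=
  {μ : Measure Y // IsProbabilityMeasure μ ∧
    ∃ x₀ : Y, (∫⁻ x, ENNReal.ofReal (dist x₀ x) ^ 2 ∂μ) < ⊤}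

/-- The quadratic transport cost between two measures. -/
def W2cost {Y : Type*} [MetricSpace Y] [MeasurableSpace Y] (μ ν : Measure Y) : ℝ≥0∞ :=
  ⨅ (π : Measure (Y × Y)) (_ : IsCoupling π μ ν),
    ∫⁻ p, ENNReal.ofReal (dist p.1 p.2) ^ 2 ∂π

/-- The quadratic Wasserstein distance. -/
def Wdist {Y : Type*} [MetricSpace Y] [MeasurableSpace Y] (μ ν : W2Space Y) : ℝ :=
  Real.sqrt (W2cost μ.1 ν.1).toReal


/-! ## Rays, complete geodesics, the boundary at infinity and the cone over it -/

/-- Geodesic rays of `X` (arbitrary nonnegative speed), parametrized by `ℝ≥0`.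
The topology (of a subtype of a product) coincides on this set with the topology of
uniform convergence on compact sets. -/
abbrev RaySpace (X : Type*) [MetricSpace X] : Type _ :=
  {γ : ℝ≥0 → X // ∃ v : ℝ, 0 ≤ v ∧ ∀ s t : ℝ≥0, dist (γ s) (γ t) = v * dist s t}

/-- Unit speed geodesic rays of `X`. -/
abbrev UnitRay (X : Type*) [MetricSpace X] : Type _ :=
  {γ : ℝ≥0 → X // ∀ s t : ℝ≥0, dist (γ s) (γ t) = dist s t}

/-- Complete geodesics of `X` (arbitrary nonnegative speed). -/
abbrev GeoLine (X : Type*) [MetricSpace X] : Type _ :=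
  {γ : ℝ → X // ∃ v : ℝ, 0 ≤ v ∧ ∀ s t : ℝ, dist (γ s) (γ t) = v * |s - t|}

/-- Complete unit speed geodesics of `X`. -/
abbrev UnitLine (X : Type*) [MetricSpace X] : Type _ :=
  {γ : ℝ → X // ∀ s t : ℝ, dist (γ s) (γ t) = |s - t|}

/-- Evaluation of a ray at time `t`. -/
def rayEval {X : Type*} [MetricSpace X] (t : ℝ≥0) : RaySpace X → X := fun γ => γ.1 t

/-- Two curves (w.r.t. a distance function `d`) are asymptotic if they stay at bounded
distance. -/
def AsymptoticMaps {A : Type*} (d : A → A → ℝ) (γ β : ℝ≥0 → A) : Prop :=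
  ∃ C : ℝ, ∀ t, d (γ t) (β t) ≤ C

/-- The asymptote relation on unit-speed rays. -/
def unitRaySetoid (X : Type*) [MetricSpace X] : Setoid (UnitRay X) where
  r γ β := AsymptoticMaps dist γ.1 β.1
  iseqv := by
    refine ⟨fun γ => ⟨0, fun t => by simp⟩, ?_, ?_⟩
    · rintro γ β ⟨C, h⟩
      exact ⟨C, fun t => by rw [dist_comm]; exact h t⟩
    · rintro γ β δ ⟨C, h⟩ ⟨C', h'⟩
      exact ⟨C + C', fun t => (dist_triangle _ _ _).trans (add_le_add (h t) (h' t))⟩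

/-- The geodesic boundary of `X`: asymptote classes of unit-speed rays, with the quotient
topology of the topology of uniform convergence on compact sets (the cone topology). -/
abbrev Boundary (X : Type*) [MetricSpace X] := Quotient (unitRaySetoid X)

/-- Apex-like points, to be collapsed when forming the cone over `B`. -/
def coneIsApex {B : Type*} : B × ℝ≥0 ⊕ Unit → Prop
  | Sum.inl p => p.2 = 0
  | Sum.inr _ => True

/-- The relation collapsing all apex-like points. -/
def coneSetoid (B : Type*) : Setoid (B × ℝ≥0 ⊕ Unit) where
  r p q := p = q ∨ (coneIsApex p ∧ coneIsApex q)
  iseqv := by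
    refine ⟨fun p => Or.inl rfl, ?_, ?_⟩
    · rintro p q (rfl | h)
      · exact Or.inl rfl
      · exact Or.inr ⟨h.2, h.1⟩
    · rintro p q r (rfl | h) (rfl | h')
      · exact Or.inl rfl
      · exact Or.inr h'
      · exact Or.inr h
      · exact Or.inr ⟨h.1, h'.2⟩

/-- The cone over a space `B`: the quotient of `B × [0,∞)` collapsing the zero level to the
apex, with the quotient topology. -/
abbrev Cone (B : Type*) := Quotient (coneSetoid B)

/-- The point of the cone over `b` at height (speed) `s`. -/
def coneMk {B : Type*} (b : B) (s : ℝ≥0) : Cone B :=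
  Quotient.mk (coneSetoid B) (Sum.inl (b, s))

/-- The apex of the cone. -/
def conePt (B : Type*) : Cone B := Quotient.mk (coneSetoid B) (Sum.inr ())

private def coneSpeedAux {B : Type*} : B × ℝ≥0 ⊕ Unit → ℝ≥0
  | Sum.inl p => p.2
  | Sum.inr _ => 0

/-- The speed (radial) coordinate of a point of the cone. -/
def coneSpeed {B : Type*} : Cone B → ℝ≥0 :=
  Quotient.lift coneSpeedAux (by
    rintro p q (rfl | ⟨h1, h2⟩)
    · rfl
    · cases p <;> cases q <;> simp_all [coneIsApex, coneSpeedAux])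

/-- The speed of a geodesic ray. -/
def raySpeed {X : Type*} [MetricSpace X] (γ : RaySpace X) : ℝ≥0 :=
  nndist (γ.1 0) (γ.1 1)

lemma raySpeed_eq {X : Type*} [MetricSpace X] (γ : RaySpace X) {v : ℝ} (hv0 : 0 ≤ v)
    (hv : ∀ s t : ℝ≥0, dist (γ.1 s) (γ.1 t) = v * dist s t) : (raySpeed γ : ℝ) = v := by
  have h1 := hv 0 1
  have h2 : dist (0 : ℝ≥0) (1 : ℝ≥0) = 1 := by rw [NNReal.dist_eq]; norm_num
  rw [h2, mul_one] at h1
  rw [show (raySpeed γ : ℝ) = dist (γ.1 0) (γ.1 1) from (dist_nndist _ _).symm, h1]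

/-- The unit reparametrization of a nonconstant ray. -/
def rayUnit {X : Type*} [MetricSpace X] (γ : RaySpace X) (h : raySpeed γ ≠ 0) : UnitRay X := by
  refine ⟨fun t => γ.1 (t / raySpeed γ), ?_⟩
  obtain ⟨v, hv0, hv⟩ := γ.2
  have hveq : (raySpeed γ : ℝ) = v := raySpeed_eq γ hv0 hv
  intro s t
  have hr : (raySpeed γ : ℝ) ≠ 0 := by
    simpa using h
  show dist (γ.1 (s / raySpeed γ)) (γ.1 (t / raySpeed γ)) = dist s t
  rw [hv, NNReal.dist_eq, NNReal.dist_eq, NNReal.coe_div, NNReal.coe_div,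
    div_sub_div_same, abs_div, abs_of_nonneg (raySpeed γ).coe_nonneg, ← hveq]
  field_simp

/-- The point at infinity (in the cone over the boundary) defined by a geodesic ray:
its asymptote class together with its speed; constant rays are sent to the apex. -/
def rayEnd {X : Type*} [MetricSpace X] (γ : RaySpace X) : Cone (Boundary X) :=
  if h : raySpeed γ = 0 then conePt (Boundary X)
  else coneMk (Quotient.mk (unitRaySetoid X) (rayUnit γ h)) (raySpeed γ)

/-! ## Asymptotic distance -/

def dInfty {X : Type*} [MetricSpace X] (γ β : ℝ≥0 → X) : ℝ :=
  Filter.limsup (fun t : ℝ≥0 => dist (γ t) (β t) / (t : ℝ)) Filter.atTop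

/-- The asymptotic (angular) distance on the boundary, computed on representative rays
(it does not depend on the choice of representatives). -/
def boundaryDist {X : Type*} [MetricSpace X] (ξ ζ : Boundary X) : ℝ :=
  dInfty (ξ.out).1 (ζ.out).1

def coneDistAux {X : Type*} [MetricSpace X] :
    Boundary X × ℝ≥0 ⊕ Unit → Boundary X × ℝ≥0 ⊕ Unit → ℝ
  | Sum.inl p, Sum.inl q =>
      Real.sqrt (((p.2 : ℝ) - (q.2 : ℝ)) ^ 2 + (p.2 : ℝ) * (q.2 : ℝ) * boundaryDist p.1 q.1 ^ 2)
  | Sum.inl p, Sum.inr _ => p.2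
  | Sum.inr _, Sum.inl q => q.2
  | Sum.inr _, Sum.inr _ => 0

/-- The asymptotic distance on the cone over the boundary (the cone metric). -/
def coneDist {X : Type*} [MetricSpace X] : Cone (Boundary X) → Cone (Boundary X) → ℝ :=
  Quotient.lift₂ coneDistAux (by
    rintro a₁ a₂ b₁ b₂ h12 h34
    rcases h12 with rfl | ⟨h1, h2⟩ <;> rcases h34 with rfl | ⟨h3, h4⟩
    · rfl
    · rcases a₁ with p | u <;> rcases a₂ with q | v <;> rcases b₂ with q' | w <;>
        simp_all [coneIsApex, coneDistAux, Real.sqrt_sq, NNReal.coe_nonneg]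
    · rcases a₂ with q | u <;> rcases a₁ with p | v <;> rcases b₁ with p' | w <;>
        simp_all [coneIsApex, coneDistAux, Real.sqrt_sq, NNReal.coe_nonneg]
    · rcases a₁ with p | u <;> rcases a₂ with q | v <;> rcases b₁ with p' | w <;>
        rcases b₂ with q' | w' <;>
        simp_all [coneIsApex, coneDistAux, Real.sqrt_sq, NNReal.coe_nonneg])


-- Borel measurable structure on the boundary and the cone over it.
instance (X : Type*) [MetricSpace X] : MeasurableSpace (Boundary X) := borel _
instance (X : Type*) [MetricSpace X] : BorelSpace (Boundary X) := ⟨rfl⟩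
instance (X : Type*) [MetricSpace X] : MeasurableSpace (Cone (Boundary X)) := borel _
instance (X : Type*) [MetricSpace X] : BorelSpace (Cone (Boundary X)) := ⟨rfl⟩

/-- The Wasserstein metric `W_∞` on measures on the cone over the boundary, built from the
cost `d_∞²`. -/
def Winfty {X : Type*} [MetricSpace X] (m m' : Measure (Cone (Boundary X))) : ℝ :=
  Real.sqrt (⨅ (π : Measure (Cone (Boundary X) × Cone (Boundary X)))
    (_ : IsCoupling π m m'),
      ∫⁻ p, ENNReal.ofReal (coneDist p.1 p.2) ^ 2 ∂π).toReal


/-! ## Visibility -/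

/-- `X` is a visibility space: any two distinct boundary points are the two endpoints of a
complete geodesic. -/
def IsVisibility (X : Type*) [MetricSpace X] : Prop :=
  ∀ α ω : UnitRay X, ¬ AsymptoticMaps dist α.1 ω.1 →
    ∃ g : ℝ → X, (∀ s t : ℝ, dist (g s) (g t) = |s - t|) ∧
      AsymptoticMaps dist (fun t : ℝ≥0 => g (-(t : ℝ))) α.1 ∧
      AsymptoticMaps dist (fun t : ℝ≥0 => g (t : ℝ)) ω.1

/-! ## Curves, length, rectifiability -/

/-- The length of a curve with respect to a distance function `d`, as a supremum over
finite monotone sequences of parameters in `[a,b]`. -/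
def curveLengthWith {A : Type*} (d : A → A → ℝ) (c : ℝ → A) (a b : ℝ) : ℝ≥0∞ :=
  ⨆ (n : ℕ) (t : Fin (n + 1) → ℝ) (_ : Monotone t) (_ : ∀ i, t i ∈ Set.Icc a b),
    ∑ i : Fin n, ENNReal.ofReal (d (c (t i.castSucc)) (c (t i.succ)))

/-- Continuity of a curve with respect to a distance function `d`, on a set of parameters. -/
def ContinuousWithRespect {A : Type*} (d : A → A → ℝ) (c : ℝ → A) (s : Set ℝ) : Prop :=
  ∀ t ∈ s, ∀ ε : ℝ, 0 < ε → ∃ δ : ℝ, 0 < δ ∧ ∀ u ∈ s, |u - t| < δ → d (c u) (c t) < ε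

/-- `W_∞` between measures on the boundary, viewed as the level `{speed = 1}` of the cone,
with cost `d_∞²`. -/
def WinftyLevel1 {X : Type*} [MetricSpace X] (m m' : Measure (Boundary X)) : ℝ :=
  Real.sqrt (⨅ (π : Measure (Boundary X × Boundary X)) (_ : IsCoupling π m m'),
    ∫⁻ p, ENNReal.ofReal (coneDist (coneMk p.1 1) (coneMk p.2 1)) ^ 2 ∂π).toReal

/-! ## Support of a measure -/

/-- The (topological) support of a measure. -/
def msupport {A : Type*} [TopologicalSpace A] [MeasurableSpace A] (μ : Measure A) : Set A :=
  {x | ∀ U : Set A, x ∈ U → IsOpen U → 0 < μ U}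

/-! ## Cyclical monotonicity and antagonism -/

/-- A set `Γ` is `c`-cyclically monotone if no cyclic permutation of the target points of a
finite family of pairs of `Γ` decreases the total cost. -/
def CyclicallyMonotone {A : Type*} (c : A → A → ℝ) (Γ : Set (A × A)) : Prop :=
  ∀ (m : ℕ) (p : Fin (m + 1) → A × A), (∀ i, p i ∈ Γ) →
    (∑ i, c (p i).1 (p i).2) ≤ ∑ i, c (p i).1 (p (i + 1)).2

/-- Two curves are antagonist if they pass through two distinct points in opposite orders. -/
def Antagonist {X : Type*} (γ β : ℝ → X) : Prop :=
  ∃ x y : X, x ≠ y ∧ (∃ s t : ℝ, s < t ∧ γ s = x ∧ γ t = y) ∧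
    (∃ s t : ℝ, s < t ∧ β s = y ∧ β t = x)

/-! ## Negative curvature, trees -/

/-- Three points lying on a common geodesic. -/
def Aligned {X : Type*} [MetricSpace X] (x y z : X) : Prop :=
  dist x y + dist y z = dist x z ∨ dist y x + dist x z = dist y z ∨
    dist x z + dist z y = dist x y

/-- `X` is negatively curved: it is not a line, and the CAT(0) comparison inequality is
strict except for aligned triangles. -/
def IsNegativelyCurved (X : Type*) [MetricSpace X] : Prop :=
  (¬ ∃ f : ℝ → X, Function.Surjective f ∧ ∀ s t : ℝ, dist (f s) (f t) = |s - t|) ∧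
  ∀ (x y z : X) (γ : ℝ → X), γ 0 = y → γ 1 = z →
    IsGeodesicOnWith dist γ (Set.Icc (0:ℝ) 1) (dist y z) → ¬ Aligned x y z →
    ∀ t ∈ Set.Ioo (0:ℝ) 1,
      dist x (γ t) ^ 2 < (1 - t) * dist x y ^ 2 + t * dist x z ^ 2 - t * (1 - t) * dist y z ^ 2

/-- A metric tree (real tree): a geodesic space satisfying the four-point 0-hyperbolicity
condition. -/
def IsRealTree (X : Type*) [MetricSpace X] : Prop :=
  IsGeodesicSpace X ∧ ∀ x y z w : X,
    dist x y + dist z w ≤ max (dist x z + dist y w) (dist x w + dist y z)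

/-! ## Ends of complete geodesics -/

/-- The forward ray of a complete geodesic. -/
def lineForward {X : Type*} [MetricSpace X] (γ : GeoLine X) : RaySpace X :=
  ⟨fun t : ℝ≥0 => γ.1 (t : ℝ), by
    obtain ⟨v, hv0, hv⟩ := γ.2
    exact ⟨v, hv0, fun s t => by rw [hv, NNReal.dist_eq]⟩⟩

/-- The backward ray of a complete geodesic. -/
def lineBackward {X : Type*} [MetricSpace X] (γ : GeoLine X) : RaySpace X :=
  ⟨fun t : ℝ≥0 => γ.1 (-(t : ℝ)), by
    obtain ⟨v, hv0, hv⟩ := γ.2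
    refine ⟨v, hv0, fun s t => ?_⟩
    rw [hv, NNReal.dist_eq]
    congr 1
    rw [abs_sub_comm]
    congr 1
    ring⟩

/-- The end at `+∞` of a complete geodesic, in the cone over the boundary. -/
def lineEndPlus {X : Type*} [MetricSpace X] (γ : GeoLine X) : Cone (Boundary X) :=
  rayEnd (lineForward γ)

/-- The end at `-∞` of a complete geodesic, in the cone over the boundary. -/
def lineEndMinus {X : Type*} [MetricSpace X] (γ : GeoLine X) : Cone (Boundary X) :=
  rayEnd (lineBackward γ)

/-- `g` is a unit complete geodesic with ends `ξ` (at `-∞`) and `ζ` (at `+∞`). -/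
def LineConnects {X : Type*} [MetricSpace X] (g : ℝ → X) (ξ ζ : Boundary X) : Prop :=
  (∀ s t : ℝ, dist (g s) (g t) = |s - t|) ∧
  (∃ γ : UnitRay X, Quotient.mk (unitRaySetoid X) γ = ξ ∧
    AsymptoticMaps dist (fun u : ℝ≥0 => g (-(u : ℝ))) γ.1) ∧
  (∃ γ : UnitRay X, Quotient.mk (unitRaySetoid X) γ = ζ ∧
    AsymptoticMaps dist (fun u : ℝ≥0 => g (u : ℝ)) γ.1)

/-- Two boundary points are antipodal if they are joined by a complete geodesic. -/
def Antipodal {X : Type*} [MetricSpace X] (ξ ζ : Boundary X) : Prop :=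
  ∃ g : ℝ → X, LineConnects g ξ ζ

/-- Two measures on the boundary are antipodal if they are concentrated on antipodal sets. -/
def AntipodalMeasures {X : Type*} [MetricSpace X] (νm νp : Measure (Boundary X)) : Prop :=
  ∃ A B : Set (Boundary X), MeasurableSet A ∧ MeasurableSet B ∧ νm A = 1 ∧ νp B = 1 ∧
    ∀ ξ ∈ A, ∀ ζ ∈ B, Antipodal ξ ζ

/-- Two measures on the boundary are uniformly antipodal if their supports are antipodal. -/
def UniformlyAntipodal {X : Type*} [MetricSpace X] (νm νp : Measure (Boundary X)) : Prop :=
  ∀ ξ ∈ msupport νm, ∀ ζ ∈ msupport νp, Antipodal ξ ζ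

/-- The distance from the base point `x₀` to the geodesic line joining two boundary points
(for trees, the Gromov product). -/
def D0 {X : Type*} [MetricSpace X] (x₀ : X) (ξ ζ : Boundary X) : ℝ :=
  sInf {r : ℝ | ∃ g : ℝ → X, LineConnects g ξ ζ ∧ ∃ t : ℝ, r = dist x₀ (g t)}

/-- The unit geodesic from `ξ` to `ζ`, parametrized so that its time-`0` point is closest to
the base point `x₀`. -/
def lineFrom {X : Type*} [MetricSpace X] (x₀ : X) (ξ ζ : Boundary X) : ℝ → X :=
  haveI : Nonempty X := ⟨x₀⟩
  Classical.epsilon fun g : ℝ → X =>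
    LineConnects g ξ ζ ∧ dist x₀ (g 0) = D0 x₀ ξ ζ

/-! ## Flows on trees -/

/-- The set of boundary points whose rays eventually lie in `C`. -/
def compBdry {X : Type*} [MetricSpace X] (C : Set X) : Set (Boundary X) :=
  {ξ | ∀ γ : UnitRay X, Quotient.mk (unitRaySetoid X) γ = ξ →
    ∃ T : ℝ≥0, ∀ t : ℝ≥0, T ≤ t → γ.1 t ∈ C}

/-- The connected components of the complement of a point. -/
def treeComps {X : Type*} [TopologicalSpace X] (x : X) : Set (Set X) :=
  {C | ∃ y : X, y ≠ x ∧ C = connectedComponentIn {x}ᶜ y}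

/-- A vertex (branch point) of a tree: the complement has at least three components. -/
def IsTreeVertex {X : Type*} [TopologicalSpace X] (x : X) : Prop :=
  ∃ C₁ C₂ C₃ : Set X, C₁ ∈ treeComps x ∧ C₂ ∈ treeComps x ∧ C₃ ∈ treeComps x ∧
    C₁ ≠ C₂ ∧ C₂ ≠ C₃ ∧ C₁ ≠ C₃

/-- The value of the signed measure `ν₊ - ν₋` on a set of boundary points. -/
def sflow {X : Type*} [MetricSpace X] (νm νp : Measure (Boundary X))
    (S : Set (Boundary X)) : ℝ :=
  (νp S).toReal - (νm S).toReal

/-- The boundary directions at `x` carrying positive flow. -/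
def posBdrySet {X : Type*} [MetricSpace X] (νm νp : Measure (Boundary X)) (x : X) :
    Set (Boundary X) :=
  ⋃ (C : Set X) (_ : C ∈ treeComps x) (_ : 0 < sflow νm νp (compBdry C)), compBdry C

/-- The boundary directions at `x` carrying negative flow. -/
def negBdrySet {X : Type*} [MetricSpace X] (νm νp : Measure (Boundary X)) (x : X) :
    Set (Boundary X) :=
  ⋃ (C : Set X) (_ : C ∈ treeComps x) (_ : sflow νm νp (compBdry C) < 0), compBdry C

/-- The flow through the point `x`. -/
def flowAt {X : Type*} [MetricSpace X] (νm νp : Measure (Boundary X)) (x : X) : ℝ :=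
  sflow νm νp (posBdrySet νm νp x)

open Classical in
/-- The specific flow through `x`: the flow through `x`, not counting the edge pointing
towards the base point `x₀` when the latter is positive (resp. negative). -/
def specificFlow {X : Type*} [MetricSpace X] (νm νp : Measure (Boundary X))
    (x₀ x : X) : ℝ :=
  if x = x₀ then flowAt νm νp x
  else if 0 < sflow νm νp (compBdry (connectedComponentIn {x}ᶜ x₀)) then
    sflow νm νp (posBdrySet νm νp x \ compBdry (connectedComponentIn {x}ᶜ x₀))
  else if sflow νm νp (compBdry (connectedComponentIn {x}ᶜ x₀)) < 0 then
    - sflow νm νp (negBdrySet νm νp x \ compBdry (connectedComponentIn {x}ᶜ x₀))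
  else flowAt νm νp x

/-- The pair `(ν₋, ν₊)` is realized as the pair of ends of a complete unit-speed geodesic of
the Wasserstein space, through a displacement interpolation `m`. -/
def RealizableEnds {X : Type*} [MetricSpace X] [MeasurableSpace X]
    (νm νp : Measure (Boundary X)) : Prop :=
  ∃ (μt : ℝ → W2Space X) (m : Measure (GeoLine X)), IsProbabilityMeasure m ∧
    (∀ s t : ℝ, Wdist (μt s) (μt t) = |s - t|) ∧
    (∀ t : ℝ, m.map (fun γ : GeoLine X => γ.1 t) = (μt t).1) ∧
    m.map lineEndMinus = νm.map (fun ξ : Boundary X => coneMk ξ 1) ∧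
    m.map lineEndPlus = νp.map (fun ξ : Boundary X => coneMk ξ 1)

/-- The cost `∫ D₀² dπ` of a transport plan (the optimal transport problem for the cost
`-D₀²` is finite iff the supremum of this quantity over all couplings is finite, and its
minimizers are the maximizers of this quantity). -/
def D0cost {X : Type*} [MetricSpace X] (x₀ : X)
    (π : Measure (Boundary X × Boundary X)) : ℝ≥0∞ :=
  ∫⁻ p, ENNReal.ofReal (D0 x₀ p.1 p.2) ^ 2 ∂π

/-- The supremum of `∫ D₀² dπ` over couplings of `(ν₋, ν₊)`. -/
def D0supCost {X : Type*} [MetricSpace X] (x₀ : X) (νm νp : Measure (Boundary X)) : ℝ≥0∞ :=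
  ⨆ (π : Measure (Boundary X × Boundary X)) (_ : IsCoupling π νm νp), D0cost x₀ π

/-! ## The geodesic boundary of the Wasserstein space -/

/-- The metric topology of the Wasserstein distance. -/
instance (Y : Type*) [MetricSpace Y] [MeasurableSpace Y] : TopologicalSpace (W2Space Y) :=
  TopologicalSpace.generateFrom
    {S | ∃ (μ : W2Space Y) (ε : ℝ), S = {ν : W2Space Y | Wdist μ ν < ε}}

/-- Unit-speed geodesic rays of the Wasserstein space. -/
abbrev W2UnitRay (X : Type*) [MetricSpace X] [MeasurableSpace X] : Type _ :=
  {f : ℝ≥0 → W2Space X // ∀ s t : ℝ≥0, Wdist (f s) (f t) = dist s t}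

/-- Probability measures on the cone over the boundary with `∫ v² dν = 1`, with the weak
topology. -/
abbrev P1Cone (X : Type*) [MetricSpace X] : Type _ :=
  {ν : ProbabilityMeasure (Cone (Boundary X)) //
    ∫⁻ c, (coneSpeed c : ℝ≥0∞) ^ 2 ∂(ν : Measure (Cone (Boundary X))) = 1}

/-- Probability measures (as plain measures) on the cone over the boundary with
`∫ v² dν = 1`. -/
abbrev P1ConeM (X : Type*) [MetricSpace X] : Type _ :=
  {ν : Measure (Cone (Boundary X)) // IsProbabilityMeasure ν ∧
    ∫⁻ c, (coneSpeed c : ℝ≥0∞) ^ 2 ∂ν = 1}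


/-! ## Locally Riemannian points -/

/-- The Riemannian length of a path `γ : [0,1] → ℝⁿ` for the metric tensor `g`. -/
def riemannianPathLength {n : ℕ}
    (g : EuclideanSpace ℝ (Fin n) → EuclideanSpace ℝ (Fin n) →L[ℝ] EuclideanSpace ℝ (Fin n))
    (γ : ℝ → EuclideanSpace ℝ (Fin n)) : ℝ :=
  ∫ t in (0:ℝ)..1, Real.sqrt (@inner ℝ _ _ (g (γ t) (deriv γ t)) (deriv γ t))

/-- The Riemannian distance in `U ⊆ ℝⁿ` for the metric tensor `g`: the infimum of
Riemannian lengths of `C¹` paths in `U` joining the two points. -/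
def riemannianDist {n : ℕ} (U : Set (EuclideanSpace ℝ (Fin n)))
    (g : EuclideanSpace ℝ (Fin n) → EuclideanSpace ℝ (Fin n) →L[ℝ] EuclideanSpace ℝ (Fin n))
    (p q : EuclideanSpace ℝ (Fin n)) : ℝ :=
  sInf {L : ℝ | ∃ γ : ℝ → EuclideanSpace ℝ (Fin n), ContDiffOn ℝ 1 γ (Set.Icc (0:ℝ) 1) ∧
    (∀ t ∈ Set.Icc (0:ℝ) 1, γ t ∈ U) ∧ γ 0 = p ∧ γ 1 = q ∧ L = riemannianPathLength g γ}

/-- `x` admits a neighborhood isometric to an open subset of a Riemannian manifold of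
dimension at least 2 (expressed in a chart: an open subset of `ℝⁿ`, `n ≥ 2`, equipped with
the distance induced by a smooth positive-definite symmetric metric tensor). -/
def IsLocallyRiemannian (X : Type*) [MetricSpace X] (x : X) : Prop :=
  ∃ n : ℕ, 2 ≤ n ∧
  ∃ (U : Set (EuclideanSpace ℝ (Fin n)))
    (g : EuclideanSpace ℝ (Fin n) → EuclideanSpace ℝ (Fin n) →L[ℝ] EuclideanSpace ℝ (Fin n))
    (V : Set X) (φ : X → EuclideanSpace ℝ (Fin n)),
    IsOpen U ∧ ContDiffOn ℝ (⊤ : ℕ∞) g U ∧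
    (∀ p ∈ U, ∀ v w : EuclideanSpace ℝ (Fin n),
      @inner ℝ _ _ (g p v) w = @inner ℝ _ _ v (g p w)) ∧
    (∀ p ∈ U, ∀ v : EuclideanSpace ℝ (Fin n), v ≠ 0 → 0 < @inner ℝ _ _ (g p v) v) ∧
    V ∈ nhds x ∧ Set.BijOn φ V U ∧
    ∀ a ∈ V, ∀ b ∈ V, dist a b = riemannianDist U g (φ a) (φ b)

/-! ## The combinatorial perpendicular Radon transform on a tree -/

/-- `y` and `z` lie in the same connected component of the graph `G` minus the vertex `x`. -/
def sameComp {V : Type*} (G : SimpleGraph V) (x y z : V) : Prop :=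
  ∃ (hy : y ≠ x) (hz : z ≠ x), (G.induce {w : V | w ≠ x}).Reachable ⟨y, hy⟩ ⟨z, hz⟩

/-- The perpendicular `⊥ˣ(ef)` of a flag: the union of `{x}` and of the components of
`G - x` containing none of the vertices of `p` (for a flag, `p = {e, f}` is a pair of
neighbors of `x`). -/
def perpSet {V : Type*} (G : SimpleGraph V) (x : V) (p : Finset V) : Set V :=
  {x} ∪ {y | ∀ e ∈ p, ¬ sameComp G x y e}

/-- The combinatorial perpendicular Radon transform of a summable function `h` on the
vertices, evaluated on a flag `(x, p)`. -/
def perpRadon {V : Type*} (G : SimpleGraph V) (h : V → ℝ) (x : V) (p : Finset V) : ℝ :=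
  ∑' y : perpSet G x p, h y



/-- A geodesic (parametrized by `[0, 1]`) from `x` to `y`, evaluated at time `t`. -/
def geodesicPoint {X : Type*} [MetricSpace X] (hX : IsGeodesicSpace X) (x y : X) (t : ℝ) : X :=
  (hX x y).choose t

section Geometry

variable {X : Type*} [MetricSpace X]

lemma geodesicPoint_zero (hX : IsGeodesicSpace X) (x y : X) : geodesicPoint hX x y 0 = x :=
  (hX x y).choose_spec.1

lemma geodesicPoint_one (hX : IsGeodesicSpace X) (x y : X) : geodesicPoint hX x y 1 = y :=
  (hX x y).choose_spec.2.1

lemma dist_geodesicPoint (hX : IsGeodesicSpace X) (x y : X) {s t : ℝ}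
    (hs : s ∈ Icc (0 : ℝ) 1) (ht : t ∈ Icc (0 : ℝ) 1) :
    dist (geodesicPoint hX x y s) (geodesicPoint hX x y t) = dist x y * |s - t| :=
  (hX x y).choose_spec.2.2 s hs t ht

lemma dist_left_geodesicPoint (hX : IsGeodesicSpace X) (x y : X) {t : ℝ}
    (ht : t ∈ Icc (0 : ℝ) 1) : dist x (geodesicPoint hX x y t) = t * dist x y := by
  have h := dist_geodesicPoint hX x y (left_mem_Icc.2 zero_le_one) ht
  rw [geodesicPoint_zero, zero_sub, abs_neg, abs_of_nonneg ht.1] at h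
  rw [h, mul_comm]

lemma dist_geodesicPoint_right (hX : IsGeodesicSpace X) (x y : X) {t : ℝ}
    (ht : t ∈ Icc (0 : ℝ) 1) : dist (geodesicPoint hX x y t) y = (1 - t) * dist x y := by
  have h := dist_geodesicPoint hX x y ht (right_mem_Icc.2 zero_le_one)
  rw [geodesicPoint_one, abs_sub_comm, abs_of_nonneg (sub_nonneg.2 ht.2)] at h
  rw [h, mul_comm]

lemma IsHadamard.dist_sq_geodesicPoint_le (hX : IsHadamard X) (p x y : X) {t : ℝ}
    (ht : t ∈ Icc (0 : ℝ) 1) :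
    dist p (geodesicPoint hX.geodesic x y t) ^ 2 ≤
      (1 - t) * dist p x ^ 2 + t * dist p y ^ 2 - t * (1 - t) * dist x y ^ 2 :=
  hX.cat0 p x y _ (geodesicPoint_zero _ x y) (geodesicPoint_one _ x y)
    (fun _ hs _ ht => dist_geodesicPoint hX.geodesic x y hs ht) t ht

lemma IsHadamard.eq_geodesicPoint (hX : IsHadamard X) {x y z : X} {t : ℝ}
    (ht : t ∈ Icc (0 : ℝ) 1) (h₁ : dist x z = t * dist x y)
    (h₂ : dist z y = (1 - t) * dist x y) : z = geodesicPoint hX.geodesic x y t := by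
  have h := hX.dist_sq_geodesicPoint_le z x y ht
  rw [dist_comm z x, h₁, h₂] at h
  have h0 : dist z (geodesicPoint hX.geodesic x y t) ^ 2 ≤ 0 := by
    refine h.trans (le_of_eq ?_)
    ring
  exact dist_eq_zero.1 (pow_eq_zero_iff two_ne_zero |>.1 (le_antisymm h0 (sq_nonneg _)))

/-- The initial part of a geodesic is a geodesic. -/
lemma IsHadamard.geodesicPoint_mul (hX : IsHadamard X) {x y z : X} {a t : ℝ}
    (ha : a ∈ Icc (0 : ℝ) 1) (ht : t ∈ Icc (0 : ℝ) 1) (h₁ : dist x y = a * dist x z)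
    (h₂ : dist y z = (1 - a) * dist x z) :
    geodesicPoint hX.geodesic x z (a * t) = geodesicPoint hX.geodesic x y t := by
  have hy := hX.eq_geodesicPoint ha h₁ h₂
  have hat : a * t ∈ Icc (0 : ℝ) 1 := ⟨mul_nonneg ha.1 ht.1, mul_le_one₀ ha.2 ht.1 ht.2⟩
  apply hX.eq_geodesicPoint ht
  · rw [dist_left_geodesicPoint _ _ _ hat, h₁]
    ring
  · have h := dist_geodesicPoint hX.geodesic x z hat ha
    rw [← hy, abs_sub_comm,
      abs_of_nonneg (sub_nonneg.2 (mul_le_of_le_one_right ha.1 ht.2))] at h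
    rw [h, h₁]
    ring

lemma IsHadamard.continuous_geodesicPoint (hX : IsHadamard X) {t : ℝ}
    (ht : t ∈ Icc (0 : ℝ) 1) :
    Continuous fun p : X × X => geodesicPoint hX.geodesic p.1 p.2 t := by
  refine continuous_iff_continuousAt.2 fun p => ?_
  rw [ContinuousAt, tendsto_iff_dist_tendsto_zero]
  have hb : Continuous fun q : X × X =>
      √((1 - t) * (t * dist q.1 q.2 + dist q.1 p.1) ^ 2 +
        t * ((1 - t) * dist q.1 q.2 + dist q.2 p.2) ^ 2 - t * (1 - t) * dist p.1 p.2 ^ 2) := by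
    fun_prop
  have hb0 := hb.tendsto p
  simp only [dist_self, add_zero] at hb0
  rw [show (1 - t) * (t * dist p.1 p.2) ^ 2 + t * ((1 - t) * dist p.1 p.2) ^ 2 -
    t * (1 - t) * dist p.1 p.2 ^ 2 = 0 by ring, Real.sqrt_zero] at hb0
  refine squeeze_zero (fun _ => dist_nonneg) (fun q => ?_) hb0
  refine Real.le_sqrt_of_sq_le ((hX.dist_sq_geodesicPoint_le _ _ _ ht).trans ?_)
  have h₁ : dist (geodesicPoint hX.geodesic q.1 q.2 t) p.1 ≤
      t * dist q.1 q.2 + dist q.1 p.1 := by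
    rw [← dist_left_geodesicPoint hX.geodesic _ _ ht, dist_comm q.1 (geodesicPoint _ _ _ _)]
    exact dist_triangle _ _ _
  have h₂ : dist (geodesicPoint hX.geodesic q.1 q.2 t) p.2 ≤
      (1 - t) * dist q.1 q.2 + dist q.2 p.2 := by
    rw [← dist_geodesicPoint_right hX.geodesic _ _ ht]
    exact dist_triangle _ _ _
  have := ht.1
  have := sub_nonneg.2 ht.2
  gcongr

/-- In a non-branching Hadamard space, a geodesic from `z` to `y` has at most one continuation of
prescribed relative length beyond `y`. -/
lemma NonBranching.eq_of_extend (hnb : NonBranching X) (hX : IsHadamard X) {x x' y z : X}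
    {p q : ℝ} (hp : 0 < p) (hq : 0 < q)
    (h₁ : q * dist x y = p * dist y z) (h₂ : dist x z = dist x y + dist y z)
    (h₁' : q * dist x' y = p * dist y z) (h₂' : dist x' z = dist x' y + dist y z) :
    x = x' := by
  have hpq : 0 < p + q := add_pos hp hq
  have ha : q / (p + q) ∈ Icc (0 : ℝ) 1 :=
    ⟨by positivity, (div_le_one hpq).2 (by linarith)⟩
  have key : ∀ w, q * dist w y = p * dist y z → dist w z = dist w y + dist y z →
      IsGeodesicOnWith dist (fun t => geodesicPoint hX.geodesic z w (t / (p + q)))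
        (Icc 0 (p + q)) (dist z w / (p + q)) ∧
      ∀ t ∈ Ioo 0 q, geodesicPoint hX.geodesic z w (t / (p + q)) =
        geodesicPoint hX.geodesic z y (t / q) := by
    intro w hw₁ hw₂
    constructor
    · intro s hs t ht
      have hI : ∀ u ∈ Icc 0 (p + q), u / (p + q) ∈ Icc (0 : ℝ) 1 := fun u hu =>
        ⟨div_nonneg hu.1 hpq.le, (div_le_one hpq).2 hu.2⟩
      rw [dist_geodesicPoint _ _ _ (hI s hs) (hI t ht), ← sub_div, abs_div, abs_of_pos hpq]
      ring
    · intro t ht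
      have hzw : dist z w = dist w z := dist_comm _ _
      have hzy : dist z y = q / (p + q) * dist z w := by
        rw [hzw, hw₂, dist_comm z y]
        field_simp
        linarith
      have hyw : dist y w = (1 - q / (p + q)) * dist z w := by
        rw [hzw, hw₂, dist_comm y w]
        field_simp
        linarith
      rw [← hX.geodesicPoint_mul ha ⟨div_nonneg ht.1.le hq.le, (div_le_one hq).2 ht.2.le⟩
        hzy hyw]
      congr 1
      field_simp
  have := hnb _ _ _ _ _ (key x h₁ h₂).1 (key x' h₁' h₂').1
    ⟨Ioo 0 q, fun t ht => ⟨ht.1.le, by linarith [ht.2]⟩, isOpen_Ioo, nonempty_Ioo.2 hq,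
      fun t ht => ((key x h₁ h₂).2 t ht).trans ((key x' h₁' h₂').2 t ht).symm⟩
    (p + q) (right_mem_Icc.2 hpq.le)
  simpa [div_self hpq.ne', geodesicPoint_one] using this

/-- The ray interpolating a sequence of points, provided the sequence is equidistant on a
geodesic. -/
def seqRay (hX : IsGeodesicSpace X) (x : ℕ → X) (t : ℝ≥0) : X :=
  geodesicPoint hX (x 0) (x (⌊t⌋₊ + 1)) (t / (⌊t⌋₊ + 1 : ℕ))

lemma IsHadamard.seqRay_eq (hX : IsHadamard X) {x : ℕ → X}
    (hx : ∀ m n : ℕ, dist (x m) (x n) = dist (m : ℝ) n * dist (x 0) (x 1)) {t : ℝ≥0} {N : ℕ}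
    (hN : ⌊t⌋₊ + 1 ≤ N) :
    seqRay hX.geodesic x t = geodesicPoint hX.geodesic (x 0) (x N) (t / N) := by
  set M := ⌊t⌋₊ + 1 with hM
  have hM0 : (0 : ℝ) < M := by positivity
  have hMN : (M : ℝ) ≤ N := by exact_mod_cast hN
  have hN0 : (0 : ℝ) < N := hM0.trans_le hMN
  have htM : (t : ℝ) ≤ M := by exact_mod_cast (Nat.lt_floor_add_one t).le
  have h0 : dist (x 0) (x N) = N * dist (x 0) (x 1) := by
    rw [hx]; simp
  rw [seqRay, ← hX.geodesicPoint_mul (x := x 0) (y := x M) (z := x N) (a := M / N)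
    (t := t / M) ⟨by positivity, (div_le_one hN0).2 hMN⟩
    ⟨by positivity, (div_le_one hM0).2 htM⟩]
  · congr 1
    field_simp
  · rw [h0, hx]
    simp
    field_simp
  · rw [h0, hx, Real.dist_eq, abs_sub_comm, abs_of_nonneg (sub_nonneg.2 hMN)]
    field_simp

lemma IsHadamard.dist_seqRay (hX : IsHadamard X) {x : ℕ → X}
    (hx : ∀ m n : ℕ, dist (x m) (x n) = dist (m : ℝ) n * dist (x 0) (x 1)) (s t : ℝ≥0) :
    dist (seqRay hX.geodesic x s) (seqRay hX.geodesic x t) =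
      dist (x 0) (x 1) * dist s t := by
  set N := max (⌊s⌋₊ + 1) (⌊t⌋₊ + 1)
  have hs : (s : ℝ) ≤ N := by
    have h := (Nat.lt_floor_add_one s).le.trans
      (by exact_mod_cast le_max_left (⌊s⌋₊ + 1) (⌊t⌋₊ + 1) : _ ≤ (N : ℝ≥0))
    exact_mod_cast h
  have ht : (t : ℝ) ≤ N := by
    have h := (Nat.lt_floor_add_one t).le.trans
      (by exact_mod_cast le_max_right (⌊s⌋₊ + 1) (⌊t⌋₊ + 1) : _ ≤ (N : ℝ≥0))
    exact_mod_cast h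
  have hN0 : (0 : ℝ) < N := by
    have : 0 < N := lt_max_of_lt_left (Nat.succ_pos _)
    exact_mod_cast this
  rw [hX.seqRay_eq hx (le_max_left _ (⌊t⌋₊ + 1)), hX.seqRay_eq hx (le_max_right (⌊s⌋₊ + 1) _),
    dist_geodesicPoint _ _ _ ⟨by positivity, (div_le_one hN0).2 hs⟩
      ⟨by positivity, (div_le_one hN0).2 ht⟩, hx, ← sub_div, abs_div, abs_of_pos hN0,
    NNReal.dist_eq, Real.dist_eq, Nat.cast_zero, zero_sub, abs_neg, abs_of_pos hN0]
  field_simp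

end Geometry

section Coupling

open scoped ProbabilityTheory

/-- Gluing of two plans along their common first marginal. -/
lemma exists_glue {A B C : Type*} [MeasurableSpace A] [MeasurableSpace B] [MeasurableSpace C]
    [StandardBorelSpace B] [Nonempty B] [StandardBorelSpace C] [Nonempty C]
    (π : Measure (A × B)) (σ : Measure (A × C)) [IsProbabilityMeasure π] [IsProbabilityMeasure σ]
    (h : π.fst = σ.fst) :
    ∃ ρ : Measure (A × B × C), IsProbabilityMeasure ρ ∧
      ρ.map (fun p => (p.1, p.2.1)) = π ∧ ρ.map (fun p => (p.1, p.2.2)) = σ := by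
  refine ⟨π.fst ⊗ₘ (π.condKernel ×ₖ σ.condKernel), inferInstance, ?_, ?_⟩
  · change Measure.map (Prod.map id Prod.fst) _ = π
    rw [← Measure.compProd_map measurable_fst, ← ProbabilityTheory.Kernel.fst_eq,
      ProbabilityTheory.Kernel.fst_prod, π.disintegrate]
  · change Measure.map (Prod.map id Prod.snd) _ = σ
    rw [← Measure.compProd_map measurable_snd, ← ProbabilityTheory.Kernel.snd_eq,
      ProbabilityTheory.Kernel.snd_prod, h, σ.disintegrate]

variable {Y : Type*} [MetricSpace Y] [MeasurableSpace Y]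

lemma IsCoupling.isProbabilityMeasure {A B : Type*} [MeasurableSpace A] [MeasurableSpace B]
    {π : Measure (A × B)} {μ : Measure A} {ν : Measure B} [IsProbabilityMeasure μ]
    (h : IsCoupling π μ ν) : IsProbabilityMeasure π := by
  have : IsProbabilityMeasure (π.map Prod.fst) := h.1 ▸ inferInstance
  exact Measure.isProbabilityMeasure_of_map (f := Prod.fst)

lemma W2cost_le {π : Measure (Y × Y)} {μ ν : Measure Y} (h : IsCoupling π μ ν) :
    W2cost μ ν ≤ ∫⁻ p, ENNReal.ofReal (dist p.1 p.2) ^ 2 ∂π :=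
  iInf₂_le π h

variable [BorelSpace Y] [SecondCountableTopology Y]

lemma lowerSemicontinuous_lintegral {E : Type*} [TopologicalSpace E] [MeasurableSpace E]
    [OpensMeasurableSpace E] {f : E → ℝ≥0} (hf : Continuous f) :
    LowerSemicontinuous fun P : ProbabilityMeasure E => ∫⁻ x, f x ∂(P : Measure E) := by
  have heq : (fun P : ProbabilityMeasure E => ∫⁻ x, f x ∂(P : Measure E)) =
      fun P : ProbabilityMeasure E =>
        ⨆ n : ℕ, ∫⁻ x, (min (f x) n : ℝ≥0) ∂(P : Measure E) := by
    funext P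
    rw [← lintegral_iSup]
    · refine lintegral_congr fun x => le_antisymm ?_ (iSup_le fun n => ?_)
      · obtain ⟨n, hn⟩ := exists_nat_ge (f x)
        exact le_iSup_of_le n (by rw [min_eq_left hn])
      · exact_mod_cast min_le_left _ _
    · intro n
      exact (hf.min continuous_const).measurable.coe_nnreal_ennreal
    · intro m n hmn x
      refine ENNReal.coe_le_coe.2 ?_
      exact_mod_cast min_le_min le_rfl (by exact_mod_cast hmn : (m : ℝ≥0) ≤ n)
  rw [heq]
  refine lowerSemicontinuous_iSup fun n => Continuous.lowerSemicontinuous ?_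
  let g : BoundedContinuousFunction E ℝ≥0 :=
    BoundedContinuousFunction.mkOfBound ⟨fun x => min (f x) n, hf.min continuous_const⟩ n
      (fun x y => by
        have h : ∀ z : E, (min (f z) n : ℝ≥0) ∈ Icc 0 (n : ℝ≥0) := fun z =>
          ⟨zero_le, min_le_right _ _⟩
        rw [ContinuousMap.coe_mk, NNReal.dist_eq]
        have hx : ((min (f x) n : ℝ≥0) : ℝ) ≤ n := by exact_mod_cast (h x).2
        have hy : ((min (f y) n : ℝ≥0) : ℝ) ≤ n := by exact_mod_cast (h y).2
        have := (min (f x) n : ℝ≥0).coe_nonneg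
        have := (min (f y) n : ℝ≥0).coe_nonneg
        rw [abs_le]
        constructor <;> linarith)
  exact continuous_iff_continuousAt.2 fun P =>
    ProbabilityMeasure.tendsto_iff_forall_lintegral_tendsto.1 tendsto_id g

/-- The infimum defining the quadratic transport cost is attained. -/
lemma exists_isCoupling_eq_W2cost [CompleteSpace Y] (μ ν : Measure Y) [IsProbabilityMeasure μ]
    [IsProbabilityMeasure ν] :
    ∃ π : Measure (Y × Y), IsCoupling π μ ν ∧
      ∫⁻ p, ENNReal.ofReal (dist p.1 p.2) ^ 2 ∂π = W2cost μ ν := by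
  let S : Set (ProbabilityMeasure (Y × Y)) :=
    {P | IsCoupling (P : Measure (Y × Y)) μ ν}
  have hSeq : S = (fun P : ProbabilityMeasure (Y × Y) =>
        P.map continuous_fst.measurable.aemeasurable) ⁻¹' {⟨μ, inferInstance⟩} ∩
      (fun P : ProbabilityMeasure (Y × Y) =>
        P.map continuous_snd.measurable.aemeasurable) ⁻¹' {⟨ν, inferInstance⟩} := by
    ext P
    exact ⟨fun h => ⟨Subtype.ext h.1, Subtype.ext h.2⟩,
      fun h => ⟨congrArg Subtype.val h.1, congrArg Subtype.val h.2⟩⟩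
  have hSclosed : IsClosed S := by
    rw [hSeq]
    exact (isClosed_singleton.preimage (ProbabilityMeasure.continuous_map continuous_fst)).inter
      (isClosed_singleton.preimage (ProbabilityMeasure.continuous_map continuous_snd))
  have hScompact : IsCompact S := by
    rw [← hSclosed.closure_eq]
    refine isCompact_closure_of_isTightMeasureSet (IsTightMeasureSet.prodMk ?_ ?_)
    · refine (isTightMeasureSet_singleton (μ := μ)).subset ?_
      rintro _ ⟨_, ⟨P, hP, rfl⟩, rfl⟩
      exact hP.1
    · refine (isTightMeasureSet_singleton (μ := ν)).subset ?_
      rintro _ ⟨_, ⟨P, hP, rfl⟩, rfl⟩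
      exact hP.2
  have hSne : S.Nonempty := by
    refine ⟨⟨μ.prod ν, inferInstance⟩, ?_, ?_⟩
    · exact Measure.fst_prod
    · exact Measure.snd_prod
  have hcost : ∀ p : Y × Y, ENNReal.ofReal (dist p.1 p.2) ^ 2 =
      ((nndist p.1 p.2 ^ 2 : ℝ≥0) : ℝ≥0∞) := by
    intro p
    rw [← coe_nndist, ENNReal.ofReal_coe_nnreal, ENNReal.coe_pow]
  have hlsc : LowerSemicontinuous fun P : ProbabilityMeasure (Y × Y) =>
      ∫⁻ p, ENNReal.ofReal (dist p.1 p.2) ^ 2 ∂(P : Measure (Y × Y)) := by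
    simp_rw [hcost]
    exact lowerSemicontinuous_lintegral (by fun_prop)
  obtain ⟨P, hP, hmin⟩ := (hlsc.lowerSemicontinuousOn S).exists_isMinOn hSne hScompact
  refine ⟨P, hP, le_antisymm (le_iInf₂ fun π hπ => ?_) (W2cost_le hP)⟩
  exact hmin (show (⟨π, hπ.isProbabilityMeasure⟩ : ProbabilityMeasure (Y × Y)) ∈ S from hπ)

lemma W2Space.lintegral_dist_sq_lt_top (μ : W2Space Y) (p : Y) :
    ∫⁻ x, ENNReal.ofReal (dist p x) ^ 2 ∂μ.1 < ⊤ := by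
  obtain ⟨hμ, x₀, hx₀⟩ := μ.2
  have hle : ∀ x, ENNReal.ofReal (dist p x) ^ 2 ≤
      2 * ENNReal.ofReal (dist p x₀) ^ 2 + 2 * ENNReal.ofReal (dist x₀ x) ^ 2 := by
    intro x
    rw [← ENNReal.ofReal_pow dist_nonneg, ← ENNReal.ofReal_pow dist_nonneg,
      ← ENNReal.ofReal_pow dist_nonneg, ← ENNReal.ofReal_ofNat 2,
      ← ENNReal.ofReal_mul zero_le_two, ← ENNReal.ofReal_mul zero_le_two,
      ← ENNReal.ofReal_add (by positivity) (by positivity)]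
    apply ENNReal.ofReal_le_ofReal
    have := dist_triangle p x₀ x
    have h2 : dist p x ^ 2 ≤ (dist p x₀ + dist x₀ x) ^ 2 := by gcongr
    nlinarith [sq_nonneg (dist p x₀ - dist x₀ x)]
  refine (lintegral_mono hle).trans_lt ?_
  rw [lintegral_add_left measurable_const, lintegral_const, measure_univ, mul_one,
    lintegral_const_mul _ (by fun_prop)]
  exact ENNReal.add_lt_top.2 ⟨ENNReal.mul_lt_top (by simp) (by simp),
    ENNReal.mul_lt_top (by simp) hx₀⟩

lemma W2cost_lt_top (μ ν : W2Space Y) : W2cost μ.1 ν.1 < ⊤ := by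
  have := μ.2.1
  have := ν.2.1
  obtain ⟨p⟩ : Nonempty Y := nonempty_of_isProbabilityMeasure μ.1
  refine (W2cost_le (π := μ.1.prod ν.1) ⟨Measure.fst_prod, Measure.snd_prod⟩).trans_lt ?_
  have hle : ∀ x : Y × Y, ENNReal.ofReal (dist x.1 x.2) ^ 2 ≤
      2 * ENNReal.ofReal (dist p x.1) ^ 2 + 2 * ENNReal.ofReal (dist p x.2) ^ 2 := by
    intro x
    rw [← ENNReal.ofReal_pow dist_nonneg, ← ENNReal.ofReal_pow dist_nonneg,
      ← ENNReal.ofReal_pow dist_nonneg, ← ENNReal.ofReal_ofNat 2,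
      ← ENNReal.ofReal_mul zero_le_two, ← ENNReal.ofReal_mul zero_le_two,
      ← ENNReal.ofReal_add (by positivity) (by positivity)]
    apply ENNReal.ofReal_le_ofReal
    have := dist_triangle_left x.1 x.2 p
    have h2 : dist x.1 x.2 ^ 2 ≤ (dist p x.1 + dist p x.2) ^ 2 := by gcongr
    nlinarith [sq_nonneg (dist p x.1 - dist p x.2)]
  refine (lintegral_mono hle).trans_lt ?_
  have hm : Measurable fun x : Y => ENNReal.ofReal (dist p x) ^ 2 := by fun_prop
  have h1 : ∫⁻ x, ENNReal.ofReal (dist p x.1) ^ 2 ∂(μ.1.prod ν.1) =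
      ∫⁻ x, ENNReal.ofReal (dist p x) ^ 2 ∂μ.1 := by
    rw [← lintegral_map (μ := μ.1.prod ν.1) hm measurable_fst, ← Measure.fst, Measure.fst_prod]
  have h2 : ∫⁻ x, ENNReal.ofReal (dist p x.2) ^ 2 ∂(μ.1.prod ν.1) =
      ∫⁻ x, ENNReal.ofReal (dist p x) ^ 2 ∂ν.1 := by
    rw [← lintegral_map (μ := μ.1.prod ν.1) hm measurable_snd, ← Measure.snd, Measure.snd_prod]
  rw [lintegral_add_left (by fun_prop), lintegral_const_mul _ (by fun_prop),
    lintegral_const_mul _ (by fun_prop), h1, h2]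
  exact ENNReal.add_lt_top.2
    ⟨ENNReal.mul_lt_top (by simp) (μ.lintegral_dist_sq_lt_top p),
    ENNReal.mul_lt_top (by simp) (ν.lintegral_dist_sq_lt_top p)⟩

end Coupling

section OptimalPair

/-- The pair of random variables `(x, y)` realizes an optimal transport plan from `μt r` to
`μt s`, where `μt` is a geodesic of speed `v` of the Wasserstein space. -/
structure IsOptimalPair {X Ω : Type*} [MetricSpace X] [MeasurableSpace X] [MeasurableSpace Ω]
    (μt : ℝ≥0 → W2Space X) (v : ℝ) (r s : ℝ≥0) (P : Measure Ω) (x y : Ω → X) : Prop where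
  map_left : P.map x = (μt r).1
  map_right : P.map y = (μt s).1
  cost : ∫⁻ ω, ENNReal.ofReal (dist (x ω) (y ω)) ^ 2 ∂P = ENNReal.ofReal ((v * dist r s) ^ 2)

variable {X Ω Ω' : Type*} [MetricSpace X] [MeasurableSpace X] [MeasurableSpace Ω]
  [MeasurableSpace Ω'] {μt : ℝ≥0 → W2Space X} {v : ℝ} {r s t : ℝ≥0} {P : Measure Ω}

lemma IsOptimalPair.isProbabilityMeasure {x y : Ω → X} (h : IsOptimalPair μt v r s P x y) :
    IsProbabilityMeasure P := by
  have := (μt r).2.1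
  have : IsProbabilityMeasure (P.map x) := h.map_left ▸ inferInstance
  exact Measure.isProbabilityMeasure_of_map (f := x)

variable [BorelSpace X] [SecondCountableTopology X]

lemma isOptimalPair_map_iff {g : Ω → Ω'} (hg : Measurable g) {x y : Ω' → X} (hx : Measurable x)
    (hy : Measurable y) :
    IsOptimalPair μt v r s (P.map g) x y ↔
      IsOptimalPair μt v r s P (fun ω => x (g ω)) (fun ω => y (g ω)) := by
  have hc : ∫⁻ ω, ENNReal.ofReal (dist (x ω) (y ω)) ^ 2 ∂(P.map g) =
      ∫⁻ ω, ENNReal.ofReal (dist (x (g ω)) (y (g ω))) ^ 2 ∂P :=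
    lintegral_map (by fun_prop) hg
  have h₁ : (P.map g).map x = P.map fun ω => x (g ω) := Measure.map_map hx hg
  have h₂ : (P.map g).map y = P.map fun ω => y (g ω) := Measure.map_map hy hg
  exact ⟨fun h => ⟨h₁ ▸ h.map_left, h₂ ▸ h.map_right, hc ▸ h.cost⟩,
    fun h => ⟨h₁.trans h.map_left, h₂.trans h.map_right, hc.trans h.cost⟩⟩

lemma W2cost_eq_of_ray (hray : ∀ s t : ℝ≥0, Wdist (μt s) (μt t) = v * dist s t)
    (r s : ℝ≥0) : W2cost (μt r).1 (μt s).1 = ENNReal.ofReal ((v * dist r s) ^ 2) := by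
  rw [← hray, Wdist, Real.sq_sqrt ENNReal.toReal_nonneg,
    ENNReal.ofReal_toReal (W2cost_lt_top _ _).ne]

lemma exists_isOptimalPair [CompleteSpace X]
    (hray : ∀ s t : ℝ≥0, Wdist (μt s) (μt t) = v * dist s t)
    (r s : ℝ≥0) :
    ∃ π : Measure (X × X), IsOptimalPair μt v r s π Prod.fst Prod.snd := by
  have := (μt r).2.1
  have := (μt s).2.1
  obtain ⟨π, hπ, hcost⟩ := exists_isCoupling_eq_W2cost (μt r).1 (μt s).1
  exact ⟨π, hπ.1, hπ.2, hcost.trans (W2cost_eq_of_ray hray r s)⟩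

lemma le_lintegral_dist_sq (hray : ∀ s t : ℝ≥0, Wdist (μt s) (μt t) = v * dist s t)
    {x y : Ω → X} (hx : Measurable x) (hy : Measurable y) (hxr : P.map x = (μt r).1)
    (hys : P.map y = (μt s).1) :
    ENNReal.ofReal ((v * dist r s) ^ 2) ≤ ∫⁻ ω, ENNReal.ofReal (dist (x ω) (y ω)) ^ 2 ∂P := by
  have hxy : Measurable fun ω => (x ω, y ω) := hx.prodMk hy
  rw [← W2cost_eq_of_ray hray]
  refine (W2cost_le (π := P.map fun ω => (x ω, y ω)) ⟨?_, ?_⟩).trans_eq ?_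
  · rw [Measure.map_map measurable_fst hxy, ← hxr]
    rfl
  · rw [Measure.map_map measurable_snd hxy, ← hys]
    rfl
  · exact lintegral_map (by fun_prop) hxy

/-- Concatenating two optimal plans along a geodesic of the Wasserstein space gives an optimal
plan, concentrated on geodesics. -/
lemma IsOptimalPair.trans (hray : ∀ s t : ℝ≥0, Wdist (μt s) (μt t) = v * dist s t)
    (hrs : r < s) (hst : s < t) {x y z : Ω → X} (hx : Measurable x) (hy : Measurable y)
    (hz : Measurable z) (hxy : IsOptimalPair μt v r s P x y)
    (hyz : IsOptimalPair μt v s t P y z) :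
    IsOptimalPair μt v r t P x z ∧ ∀ᵐ ω ∂P,
      ((t : ℝ) - s) * dist (x ω) (y ω) = (s - r) * dist (y ω) (z ω) ∧
      dist (x ω) (z ω) = dist (x ω) (y ω) + dist (y ω) (z ω) := by
  set p : ℝ := s - r with hp
  set q : ℝ := t - s with hq
  have hp0 : 0 < p := sub_pos.2 hrs
  have hq0 : 0 < q := sub_pos.2 hst
  have hdrs : dist r s = p := by
    rw [dist_comm, NNReal.dist_eq, abs_of_pos hp0]
  have hdst : dist s t = q := by
    rw [dist_comm, NNReal.dist_eq, abs_of_pos hq0]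
  have hdrt : dist r t = p + q := by
    rw [dist_comm, NNReal.dist_eq, hp, hq, abs_of_pos] <;> linarith
  let C : Ω → ℝ≥0∞ := fun ω => ENNReal.ofReal (dist (x ω) (z ω)) ^ 2
  let F : Ω → ℝ≥0∞ := fun ω =>
    ENNReal.ofReal ((p + q) / p) * ENNReal.ofReal (dist (x ω) (y ω)) ^ 2 +
      ENNReal.ofReal ((p + q) / q) * ENNReal.ofReal (dist (y ω) (z ω)) ^ 2
  have hFω : ∀ ω, F ω = ENNReal.ofReal
      ((p + q) / p * dist (x ω) (y ω) ^ 2 + (p + q) / q * dist (y ω) (z ω) ^ 2) := by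
    intro ω
    rw [ENNReal.ofReal_add (by positivity) (by positivity), ENNReal.ofReal_mul (by positivity),
      ENNReal.ofReal_mul (by positivity), ENNReal.ofReal_pow dist_nonneg,
      ENNReal.ofReal_pow dist_nonneg]
  have hCω : ∀ ω, C ω = ENNReal.ofReal (dist (x ω) (z ω) ^ 2) := fun ω =>
    (ENNReal.ofReal_pow dist_nonneg _).symm
  have hid : ∀ a b : ℝ, (p + q) / p * a ^ 2 + (p + q) / q * b ^ 2 =
      (a + b) ^ 2 + (q * a - p * b) ^ 2 / (p * q) := by
    intro a b
    field_simp
    ring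
  have hCF : ∀ ω, C ω ≤ F ω := by
    intro ω
    rw [hFω, hCω, hid]
    apply ENNReal.ofReal_le_ofReal
    have h1 : dist (x ω) (z ω) ^ 2 ≤ (dist (x ω) (y ω) + dist (y ω) (z ω)) ^ 2 := by
      gcongr
      exact dist_triangle _ _ _
    have h2 : 0 ≤ (q * dist (x ω) (y ω) - p * dist (y ω) (z ω)) ^ 2 / (p * q) := by positivity
    linarith
  have hFint : ∫⁻ ω, F ω ∂P = ENNReal.ofReal ((v * dist r t) ^ 2) := by
    rw [lintegral_add_left (by fun_prop), lintegral_const_mul _ (by fun_prop),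
      lintegral_const_mul _ (by fun_prop), hxy.cost, hyz.cost, hdrs, hdst, hdrt,
      ← ENNReal.ofReal_mul (by positivity), ← ENNReal.ofReal_mul (by positivity),
      ← ENNReal.ofReal_add (by positivity) (by positivity)]
    congr 1
    field_simp
  have hCint := le_lintegral_dist_sq hray hx hz hxy.map_left hyz.map_right
  have hCF' : ∫⁻ ω, C ω ∂P ≤ ∫⁻ ω, F ω ∂P := lintegral_mono hCF
  refine ⟨⟨hxy.map_left, hyz.map_right, le_antisymm (hCF'.trans_eq hFint) hCint⟩, ?_⟩
  have hae : C =ᵐ[P] F := by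
    refine ae_eq_of_ae_le_of_lintegral_le (ae_of_all _ hCF) ?_ (by fun_prop)
      (hFint.trans_le hCint)
    exact (hCF'.trans_lt (hFint ▸ ENNReal.ofReal_lt_top)).ne
  filter_upwards [hae] with ω hω
  rw [hCω, hFω, ENNReal.ofReal_eq_ofReal_iff (by positivity) (by positivity), hid] at hω
  have h1 := dist_triangle (x ω) (y ω) (z ω)
  have h2 : dist (x ω) (z ω) ^ 2 ≤ (dist (x ω) (y ω) + dist (y ω) (z ω)) ^ 2 := by gcongr
  have h3 : 0 ≤ (q * dist (x ω) (y ω) - p * dist (y ω) (z ω)) ^ 2 / (p * q) := by positivity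
  have h4 : (q * dist (x ω) (y ω) - p * dist (y ω) (z ω)) ^ 2 / (p * q) = 0 := by linarith
  constructor
  · rw [div_eq_zero_iff, pow_eq_zero_iff two_ne_zero] at h4
    have := h4.resolve_right (by positivity)
    linarith
  · rw [h4, add_zero] at hω
    exact (pow_left_inj₀ dist_nonneg (by positivity) two_ne_zero).1 hω

/-- Given its final point, the initial point of an optimal plan along a ray is determined. -/
lemma IsOptimalPair.ae_eq [CompleteSpace X] (hX : IsHadamard X) (hnb : NonBranching X)
    (hray : ∀ s t : ℝ≥0, Wdist (μt s) (μt t) = v * dist s t)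
    (hrs : r < s) {x x' y : Ω → X} (hx : Measurable x) (hx' : Measurable x')
    (hy : Measurable y) (hxy : IsOptimalPair μt v r s P x y)
    (hxy' : IsOptimalPair μt v r s P x' y) : x =ᵐ[P] x' := by
  have hst : s < s + 1 := lt_add_one s
  obtain ⟨σ, hσ⟩ := exists_isOptimalPair hray s (s + 1)
  have := hσ.isProbabilityMeasure
  have := hxy.isProbabilityMeasure
  obtain ⟨ω⟩ : Nonempty Ω := nonempty_of_isProbabilityMeasure P
  have : Nonempty X := ⟨x ω⟩
  have hg : Measurable fun ω => (y ω, x ω, x' ω) := hy.prodMk (hx.prodMk hx')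
  have := Measure.isProbabilityMeasure_map (μ := P) hg.aemeasurable
  obtain ⟨ρ, -, hρ₁, hρ₂⟩ := exists_glue (P.map fun ω => (y ω, x ω, x' ω)) σ (by
    rw [Measure.fst, Measure.fst, Measure.map_map measurable_fst hg]
    exact hxy.map_right.trans hσ.map_left.symm)
  have hm₁ : Measurable fun p : X × (X × X) × X => (p.1, p.2.1) := by fun_prop
  have hm₂ : Measurable fun p : X × (X × X) × X => (p.1, p.2.2) := by fun_prop
  have h₁ : IsOptimalPair μt v r s ρ (fun p => p.2.1.1) (fun p => p.1) := by
    rw [← isOptimalPair_map_iff hg (x := fun p => p.2.1) (y := fun p => p.1) (by fun_prop)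
      (by fun_prop), ← hρ₁, isOptimalPair_map_iff hm₁ (by fun_prop) (by fun_prop)] at hxy
    exact hxy
  have h₁' : IsOptimalPair μt v r s ρ (fun p => p.2.1.2) (fun p => p.1) := by
    rw [← isOptimalPair_map_iff hg (x := fun p => p.2.2) (y := fun p => p.1) (by fun_prop)
      (by fun_prop), ← hρ₁, isOptimalPair_map_iff hm₁ (by fun_prop) (by fun_prop)] at hxy'
    exact hxy'
  have h₂ : IsOptimalPair μt v s (s + 1) ρ (fun p => p.1) (fun p => p.2.2) := by
    rw [← hρ₂, isOptimalPair_map_iff hm₂ (by fun_prop) (by fun_prop)] at hσ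
    exact hσ
  have hae : ∀ᵐ p ∂ρ, p.2.1.1 = p.2.1.2 := by
    filter_upwards [(h₁.trans hray hrs hst (by fun_prop) (by fun_prop) (by fun_prop) h₂).2,
      (h₁'.trans hray hrs hst (by fun_prop) (by fun_prop) (by fun_prop) h₂).2] with p h h'
    exact hnb.eq_of_extend hX (sub_pos.2 (NNReal.coe_lt_coe.2 hrs))
      (sub_pos.2 (NNReal.coe_lt_coe.2 hst)) h.1 h.2 h'.1 h'.2
  have hS : MeasurableSet {p : X × X × X | p.2.1 = p.2.2} :=
    measurableSet_eq_fun (by fun_prop) (by fun_prop)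
  have hae' : ∀ᵐ p ∂(ρ.map fun p : X × (X × X) × X => (p.1, p.2.1)), p.2.1 = p.2.2 :=
    (ae_map_iff hm₁.aemeasurable hS).2 hae
  rw [hρ₁] at hae'
  exact (ae_map_iff hg.aemeasurable hS).1 hae'

/-- Uniqueness of the joint law of random variables which are optimally coupled to a common
later time. -/
lemma map_eq_of_isOptimalPair [CompleteSpace X] (hX : IsHadamard X) (hnb : NonBranching X)
    (hray : ∀ s t : ℝ≥0, Wdist (μt s) (μt t) = v * dist s t)
    {ι : Type*} [Finite ι] {r : ι → ℝ≥0} (hrs : ∀ i, r i < s) {P' : Measure Ω'}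
    [IsProbabilityMeasure P] [IsProbabilityMeasure P']
    {x : ι → Ω → X} {y : Ω → X} {x' : ι → Ω' → X} {y' : Ω' → X}
    (hx : ∀ i, Measurable (x i)) (hx' : ∀ i, Measurable (x' i)) (hy : Measurable y)
    (hy' : Measurable y') (hys : P.map y = (μt s).1) (hys' : P'.map y' = (μt s).1)
    (hxy : ∀ i, IsOptimalPair μt v (r i) s P (x i) y)
    (hxy' : ∀ i, IsOptimalPair μt v (r i) s P' (x' i) y') :
    P.map (fun ω => (y ω, fun i => x i ω)) = P'.map (fun ω => (y' ω, fun i => x' i ω)) := by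
  have := Fintype.ofFinite ι
  obtain ⟨ω⟩ : Nonempty Ω := nonempty_of_isProbabilityMeasure P
  have : Nonempty X := ⟨y ω⟩
  have hg : Measurable fun ω => (y ω, fun i => x i ω) := hy.prodMk (measurable_pi_lambda _ hx)
  have hg' : Measurable fun ω => (y' ω, fun i => x' i ω) :=
    hy'.prodMk (measurable_pi_lambda _ hx')
  have := Measure.isProbabilityMeasure_map (μ := P) hg.aemeasurable
  have := Measure.isProbabilityMeasure_map (μ := P') hg'.aemeasurable
  obtain ⟨ρ, -, hρ₁, hρ₂⟩ := exists_glue (P.map fun ω => (y ω, fun i => x i ω))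
    (P'.map fun ω => (y' ω, fun i => x' i ω)) (by
      rw [Measure.fst, Measure.fst, Measure.map_map measurable_fst hg,
        Measure.map_map measurable_fst hg']
      exact hys.trans hys'.symm)
  have hm₁ : Measurable fun p : X × (ι → X) × (ι → X) => (p.1, p.2.1) := by fun_prop
  have hm₂ : Measurable fun p : X × (ι → X) × (ι → X) => (p.1, p.2.2) := by fun_prop
  have hae : ∀ᵐ p ∂ρ, ∀ i, p.2.1 i = p.2.2 i := by
    refine ae_all_iff.2 fun i => ?_
    have h₁ : IsOptimalPair μt v (r i) s ρ (fun p => p.2.1 i) (fun p => p.1) := by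
      have h := hxy i
      rw [← isOptimalPair_map_iff hg (x := fun p => p.2 i) (y := fun p => p.1) (by fun_prop)
        (by fun_prop), ← hρ₁, isOptimalPair_map_iff hm₁ (by fun_prop) (by fun_prop)] at h
      exact h
    have h₂ : IsOptimalPair μt v (r i) s ρ (fun p => p.2.2 i) (fun p => p.1) := by
      have h := hxy' i
      rw [← isOptimalPair_map_iff hg' (x := fun p => p.2 i) (y := fun p => p.1) (by fun_prop)
        (by fun_prop), ← hρ₂, isOptimalPair_map_iff hm₂ (by fun_prop) (by fun_prop)] at h
      exact h
    exact h₁.ae_eq hX hnb hray (hrs i) (by fun_prop) (by fun_prop) (by fun_prop) h₂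
  rw [← hρ₁, ← hρ₂]
  refine Measure.map_congr ?_
  filter_upwards [hae] with p hp
  rw [funext hp]

end OptimalPair

section RayMeasure

variable {X : Type*} [MetricSpace X]

lemma dist_rayEval (γ : RaySpace X) (s t : ℝ≥0) :
    dist (rayEval s γ) (rayEval t γ) = dist (rayEval 0 γ) (rayEval 1 γ) * dist s t := by
  obtain ⟨u, -, h⟩ := γ.2
  have h01 : dist (0 : ℝ≥0) 1 = 1 := by simp [NNReal.dist_eq]
  simp only [rayEval]
  rw [h s t, h 0 1, h01, mul_one]

variable [MeasurableSpace X]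

lemma measurable_rayEval (t : ℝ≥0) : Measurable (rayEval t : RaySpace X → X) :=
  (measurable_pi_apply t).comp measurable_subtype_coe

/-- Two probability measures on the space of rays agree as soon as their finite-dimensional
marginals do. -/
lemma RaySpace.measure_ext {μ ν : Measure (RaySpace X)} [IsProbabilityMeasure μ]
    (h : ∀ F : Finset ℝ≥0, μ.map (fun γ (i : F) => rayEval (i : ℝ≥0) γ) =
      ν.map (fun γ (i : F) => rayEval (i : ℝ≥0) γ)) : μ = ν := by
  have hval : Measurable (Subtype.val : RaySpace X → ℝ≥0 → X) := measurable_subtype_coe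
  have := Measure.isProbabilityMeasure_map (μ := μ) hval.aemeasurable
  have hmap : μ.map Subtype.val = ν.map Subtype.val := by
    refine IsProjectiveLimit.unique
      (P := fun F : Finset ℝ≥0 => μ.map (fun γ (i : F) => rayEval (i : ℝ≥0) γ)) ?_ ?_
    · intro F
      exact Measure.map_map (Finset.measurable_restrict F) hval
    · intro F
      exact (Measure.map_map (Finset.measurable_restrict F) hval).trans (h F).symm
  ext S hS
  obtain ⟨T, hT, rfl⟩ := hS
  rw [← Measure.map_apply hval hT, hmap, Measure.map_apply hval hT]

variable [BorelSpace X] [SecondCountableTopology X]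
  {μt : ℝ≥0 → W2Space X} {v : ℝ}

lemma lintegral_dist_rayEval_sq (μ : Measure (RaySpace X)) (s t : ℝ≥0) :
    ∫⁻ γ, ENNReal.ofReal (dist (rayEval s γ) (rayEval t γ)) ^ 2 ∂μ =
      ENNReal.ofReal (dist s t) ^ 2 *
        ∫⁻ γ, ENNReal.ofReal (dist (rayEval 0 γ) (rayEval 1 γ)) ^ 2 ∂μ := by
  have h0 : Measurable (rayEval 0 : RaySpace X → X) := measurable_rayEval 0
  have h1 : Measurable (rayEval 1 : RaySpace X → X) := measurable_rayEval 1
  rw [← lintegral_const_mul _ (by fun_prop)]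
  refine lintegral_congr fun γ => ?_
  rw [dist_rayEval, mul_comm, ENNReal.ofReal_mul dist_nonneg, mul_pow]

lemma rpow_lintegral_dist_triangle {Ω : Type*} [MeasurableSpace Ω] (P : Measure Ω)
    {x y z : Ω → X} (hx : Measurable x) (hy : Measurable y) (hz : Measurable z) :
    (∫⁻ ω, ENNReal.ofReal (dist (x ω) (z ω)) ^ 2 ∂P) ^ (1 / 2 : ℝ) ≤
      (∫⁻ ω, ENNReal.ofReal (dist (x ω) (y ω)) ^ 2 ∂P) ^ (1 / 2 : ℝ) +
      (∫⁻ ω, ENNReal.ofReal (dist (y ω) (z ω)) ^ 2 ∂P) ^ (1 / 2 : ℝ) := by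
  have h := ENNReal.lintegral_Lp_add_le (μ := P) (p := 2)
    (f := fun ω => ENNReal.ofReal (dist (x ω) (y ω)))
    (g := fun ω => ENNReal.ofReal (dist (y ω) (z ω))) (by fun_prop) (by fun_prop) one_le_two
  simp only [ENNReal.rpow_ofNat, Pi.add_apply] at h
  refine le_trans ?_ h
  gcongr with ω
  rw [← ENNReal.ofReal_add dist_nonneg dist_nonneg]
  exact ENNReal.ofReal_le_ofReal (dist_triangle _ _ _)

lemma rpow_half_ofReal_sq {a : ℝ} (ha : 0 ≤ a) :
    ENNReal.ofReal (a ^ 2) ^ (1 / 2 : ℝ) = ENNReal.ofReal a := by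
  rw [ENNReal.ofReal_rpow_of_nonneg (by positivity) (by norm_num), ← Real.sqrt_eq_rpow,
    Real.sqrt_sq ha]

/-- The mean squared speed of a displacement interpolation is at most the squared speed of the
geodesic ray of the Wasserstein space. -/
lemma lintegral_speed_sq_le [CompleteSpace X] (hv : 0 ≤ v)
    (hray : ∀ s t : ℝ≥0, Wdist (μt s) (μt t) = v * dist s t) {μ : Measure (RaySpace X)}
    [IsProbabilityMeasure μ] (hμ : ∀ t : ℝ≥0, μ.map (rayEval t) = (μt t).1) :
    ∫⁻ γ, ENNReal.ofReal (dist (rayEval 0 γ) (rayEval 1 γ)) ^ 2 ∂μ ≤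
      ENNReal.ofReal (v ^ 2) := by
  set E := ∫⁻ γ, ENNReal.ofReal (dist (rayEval 0 γ) (rayEval 1 γ)) ^ 2 ∂μ
  obtain ⟨γ₀⟩ : Nonempty (RaySpace X) := nonempty_of_isProbabilityMeasure μ
  let p : X := rayEval 0 γ₀
  let N : ℝ≥0 → ℝ≥0∞ := fun t => (∫⁻ x, ENNReal.ofReal (dist p x) ^ 2 ∂(μt t).1) ^ (1 / 2 : ℝ)
  have hN0 : N 0 ≠ ⊤ :=
    (ENNReal.rpow_lt_top_of_nonneg (by norm_num) ((μt 0).lintegral_dist_sq_lt_top p).ne).ne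
  have hdist : ∀ t : ℝ≥0, dist 0 t = (t : ℝ) := fun t => by simp [NNReal.dist_eq]
  have hN : ∀ t, N t ≤ N 0 + ENNReal.ofReal (v * t) := by
    intro t
    obtain ⟨π, hπ⟩ := exists_isOptimalPair hray 0 t
    have h := rpow_lintegral_dist_triangle π (x := fun _ => p) measurable_const
      measurable_fst measurable_snd
    rw [hπ.cost, hdist, rpow_half_ofReal_sq (by positivity)] at h
    have hm : Measurable fun x => ENNReal.ofReal (dist p x) ^ 2 := by fun_prop
    simp only [N]
    rw [← hπ.map_left, ← hπ.map_right, lintegral_map hm measurable_fst,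
      lintegral_map hm measurable_snd]
    exact h
  have hbound : ∀ t : ℝ≥0, (t : ℝ≥0∞) * E ^ (1 / 2 : ℝ) ≤
      2 * N 0 + t * ENNReal.ofReal v := by
    intro t
    have h := rpow_lintegral_dist_triangle μ (y := fun _ => p) (measurable_rayEval 0)
      measurable_const (measurable_rayEval t)
    have hm : Measurable fun x => ENNReal.ofReal (dist p x) ^ 2 := by fun_prop
    rw [lintegral_dist_rayEval_sq, hdist, ENNReal.mul_rpow_of_nonneg _ _ (by norm_num),
      ← ENNReal.ofReal_pow t.coe_nonneg, rpow_half_ofReal_sq t.coe_nonneg,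
      ENNReal.ofReal_coe_nnreal] at h
    refine h.trans ?_
    simp_rw [dist_comm _ p]
    rw [← lintegral_map hm (measurable_rayEval 0), ← lintegral_map hm (measurable_rayEval t),
      hμ, hμ]
    refine (add_le_add_right (hN t) (N 0)).trans_eq ?_
    rw [mul_comm v, ENNReal.ofReal_mul t.coe_nonneg, ENNReal.ofReal_coe_nnreal]
    ring
  have hE : E ^ (1 / 2 : ℝ) ≤ ENNReal.ofReal v := by
    refine ENNReal.le_of_forall_pos_le_add fun ε hε _ => ?_
    obtain ⟨n, hn⟩ := exists_nat_gt (((2 * N 0).toNNReal) / ε)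
    have h2N : 2 * N 0 ≠ ⊤ := ENNReal.mul_ne_top (by simp) hN0
    have hnε : 2 * N 0 ≤ (n : ℝ≥0) * (ε : ℝ≥0∞) := by
      rw [← ENNReal.coe_toNNReal h2N, ← ENNReal.coe_mul]
      exact ENNReal.coe_le_coe.2 ((div_lt_iff₀ hε).1 hn).le
    have hn0 : (n : ℝ≥0) ≠ 0 := (lt_of_le_of_lt zero_le hn).ne'
    have h := (hbound n).trans (add_le_add_left hnε _)
    rw [← mul_add, add_comm (ε : ℝ≥0∞)] at h
    exact (ENNReal.mul_le_mul_iff_right (by exact_mod_cast hn0) ENNReal.coe_ne_top).1 h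
  have h := ENNReal.rpow_le_rpow hE zero_le_two
  rw [← ENNReal.rpow_mul] at h
  norm_num at h
  rwa [ENNReal.ofReal_pow hv]

lemma isOptimalPair_rayEval [CompleteSpace X] (hv : 0 ≤ v)
    (hray : ∀ s t : ℝ≥0, Wdist (μt s) (μt t) = v * dist s t) {μ : Measure (RaySpace X)}
    [IsProbabilityMeasure μ] (hμ : ∀ t : ℝ≥0, μ.map (rayEval t) = (μt t).1) (s t : ℝ≥0) :
    IsOptimalPair μt v s t μ (rayEval s) (rayEval t) := by
  refine ⟨hμ s, hμ t, le_antisymm ?_ (le_lintegral_dist_sq hray (measurable_rayEval s)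
    (measurable_rayEval t) (hμ s) (hμ t))⟩
  rw [lintegral_dist_rayEval_sq, mul_pow, ENNReal.ofReal_mul (by positivity), mul_comm,
    ENNReal.ofReal_pow dist_nonneg]
  gcongr
  exact lintegral_speed_sq_le hv hray hμ

lemma displacement_interpolation_ext [CompleteSpace X] (hX : IsHadamard X) (hnb : NonBranching X)
    (hv : 0 ≤ v)
    (hray : ∀ s t : ℝ≥0, Wdist (μt s) (μt t) = v * dist s t) {μ ν : Measure (RaySpace X)}
    [IsProbabilityMeasure μ] [IsProbabilityMeasure ν]
    (hμ : ∀ t : ℝ≥0, μ.map (rayEval t) = (μt t).1)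
    (hν : ∀ t : ℝ≥0, ν.map (rayEval t) = (μt t).1) : μ = ν := by
  refine RaySpace.measure_ext fun F => ?_
  have hF : ∀ i : F, (i : ℝ≥0) < F.sup id + 1 := fun i =>
    lt_of_le_of_lt (Finset.le_sup (f := id) i.2) (lt_add_one _)
  have h := congrArg (Measure.map Prod.snd) (map_eq_of_isOptimalPair hX hnb hray hF
    (x := fun i => rayEval (i : ℝ≥0)) (x' := fun i => rayEval (i : ℝ≥0))
    (fun i => measurable_rayEval _) (fun i => measurable_rayEval _)
    (measurable_rayEval _) (measurable_rayEval _) (hμ _) (hν _)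
    (fun i => isOptimalPair_rayEval hv hray hμ _ _)
    (fun i => isOptimalPair_rayEval hv hray hν _ _))
  rwa [Measure.map_map measurable_snd ((measurable_rayEval _).prodMk
      (measurable_pi_lambda _ fun i => measurable_rayEval _)),
    Measure.map_map measurable_snd ((measurable_rayEval _).prodMk
      (measurable_pi_lambda _ fun i => measurable_rayEval _))] at h

end RayMeasure

section Existence

open scoped ProbabilityTheory
open ProbabilityTheory

lemma map_prodMap_compProd_comap {A B C : Type*} [MeasurableSpace A] [MeasurableSpace B]
    [MeasurableSpace C] (m : Measure A) [IsProbabilityMeasure m] (κ : Kernel B C)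
    [IsMarkovKernel κ] {f : A → B} (hf : Measurable f) :
    (m ⊗ₘ κ.comap f hf).map (Prod.map f id) = m.map f ⊗ₘ κ := by
  have := Measure.isProbabilityMeasure_map (μ := m) hf.aemeasurable
  ext S hS
  have hp : Measurable (Prod.map f (id : C → C)) := hf.prodMap measurable_id
  rw [Measure.map_apply hp hS, Measure.compProd_apply (hp hS), Measure.compProd_apply hS,
    lintegral_map (Kernel.measurable_kernel_prodMk_left hS) hf]
  rfl

/-- Consecutive couplings are the two-step marginals of a Markov chain. -/
lemma exists_measure_map_consecutive {A : Type*} [MeasurableSpace A] [StandardBorelSpace A]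
    [Nonempty A] (π : ℕ → Measure (A × A)) [∀ n, IsProbabilityMeasure (π n)]
    (h : ∀ n, (π n).snd = (π (n + 1)).fst) :
    ∃ P : Measure (ℕ → A), IsProbabilityMeasure P ∧
      ∀ n, P.map (fun x => (x n, x (n + 1))) = π n := by
  let last : ∀ n : ℕ, (Finset.Iic n → A) → A := fun n x => x ⟨n, Finset.mem_Iic.2 (le_refl n)⟩
  have hlast : ∀ n, Measurable (last n) := fun n => measurable_pi_apply _
  let κ : ∀ n : ℕ, Kernel (Finset.Iic n → A) A := fun n =>
    (π n).condKernel.comap (last n) (hlast n)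
  let P : Measure (ℕ → A) := Kernel.trajMeasure (X := fun _ => A) (π 0).fst κ
  have hstep : ∀ n, P.map (fun x => x n) = (π n).fst →
      P.map (fun x => (x n, x (n + 1))) = π n := by
    intro n hn
    have hres : Measurable (Preorder.frestrictLe (π := fun _ => A) n) := by fun_prop
    have := Measure.isProbabilityMeasure_map (μ := P) hres.aemeasurable
    have key : P.map (Preorder.frestrictLe n) ⊗ₘ κ n =
        P.map (fun x => (Preorder.frestrictLe (π := fun _ => A) n x, x (n + 1))) :=
      Kernel.map_frestrictLe_trajMeasure_compProd_eq_map_trajMeasure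
    have key' := congrArg (Measure.map (Prod.map (last n) id)) key
    rw [map_prodMap_compProd_comap, Measure.map_map (hlast n) hres,
      Measure.map_map ((hlast n).prodMap measurable_id) (by fun_prop)] at key'
    have h1 : P.map (last n ∘ Preorder.frestrictLe n) = (π n).fst := hn
    rw [h1, Measure.disintegrate] at key'
    exact key'.symm
  have h0 : P.map (fun x => x 0) = (π 0).fst := by
    have hres : Measurable (Preorder.frestrictLe (π := fun _ : ℕ => A) 0) := by fun_prop
    have h1 : P.map (Preorder.frestrictLe 0) = (π 0).fst.map
        (MeasurableEquiv.piUnique fun _ : Finset.Iic 0 => A).symm := by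
      have hP : P = Kernel.traj (X := fun _ => A) κ 0 ∘ₘ (π 0).fst.map
        (MeasurableEquiv.piUnique fun _ : Finset.Iic 0 => A).symm := rfl
      rw [hP, Measure.map_comp _ _ hres, Kernel.traj_map_frestrictLe,
        Kernel.partialTraj_self, Measure.id_comp]
    have h2 := congrArg (Measure.map (last 0)) h1
    rw [Measure.map_map (hlast 0) hres, Measure.map_map (hlast 0) (by fun_prop)] at h2
    exact h2.trans Measure.map_id
  have hall : ∀ n, P.map (fun x => x n) = (π n).fst := by
    intro n
    induction n with
    | zero => exact h0
    | succ n ih =>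
      rw [← h, ← hstep n ih, Measure.snd, Measure.map_map measurable_snd (by fun_prop)]
      rfl
  exact ⟨P, inferInstance, fun n => hstep n (hall n)⟩

variable {X : Type*} [MetricSpace X]

open Classical in
/-- The ray through the points of a sequence if there is one starting at its first point, and a
constant ray otherwise. -/
def rayOfSeq (hX : IsHadamard X) (x : ℕ → X) : RaySpace X :=
  if hx : ∀ m n : ℕ, dist (x m) (x n) = dist (m : ℝ) n * dist (x 0) (x 1) then
    ⟨seqRay hX.geodesic x, dist (x 0) (x 1), dist_nonneg, hX.dist_seqRay hx⟩
  else ⟨fun _ => x 0, 0, le_rfl, by simp⟩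

lemma rayEval_rayOfSeq (hX : IsHadamard X) {x : ℕ → X}
    (hx : ∀ m n : ℕ, dist (x m) (x n) = dist (m : ℝ) n * dist (x 0) (x 1)) (t : ℝ≥0) :
    rayEval t (rayOfSeq hX x) = seqRay hX.geodesic x t := by
  rw [rayOfSeq, dif_pos hx]
  rfl

lemma div_floor_add_one_mem_Icc (t : ℝ≥0) : (t / (⌊t⌋₊ + 1 : ℕ) : ℝ) ∈ Icc (0 : ℝ) 1 := by
  have htN : (t : ℝ) ≤ (⌊t⌋₊ + 1 : ℕ) := by exact_mod_cast (Nat.lt_floor_add_one t).le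
  exact ⟨by positivity, (div_le_one (by positivity)).2 htN⟩

variable [MeasurableSpace X] [BorelSpace X]
  [SecondCountableTopology X] {μt : ℝ≥0 → W2Space X} {v : ℝ}

/-- There is a random sequence realizing optimal plans between consecutive integer times. -/
lemma exists_isOptimalPair_consecutive [CompleteSpace X]
    (hray : ∀ s t : ℝ≥0, Wdist (μt s) (μt t) = v * dist s t) :
    ∃ P : Measure (ℕ → X), IsProbabilityMeasure P ∧
      ∀ n : ℕ, IsOptimalPair μt v n (n + 1 : ℕ) P (fun x => x n) (fun x => x (n + 1)) := by
  have := (μt 0).2.1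
  have : Nonempty X := nonempty_of_isProbabilityMeasure (μt 0).1
  choose π hπ using fun n : ℕ => exists_isOptimalPair hray (n : ℝ≥0) (n + 1 : ℕ)
  have := fun n => (hπ n).isProbabilityMeasure
  obtain ⟨P, hP, hPπ⟩ := exists_measure_map_consecutive π
    fun n => (hπ n).map_right.trans (hπ (n + 1)).map_left.symm
  refine ⟨P, hP, fun n => ?_⟩
  have h := hπ n
  rw [← hPπ n] at h
  exact (isOptimalPair_map_iff (by fun_prop) measurable_fst measurable_snd).1 h

lemma isOptimalPair_of_consecutive
    (hray : ∀ s t : ℝ≥0, Wdist (μt s) (μt t) = v * dist s t) {P : Measure (ℕ → X)}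
    (hP : ∀ n : ℕ, IsOptimalPair μt v n (n + 1 : ℕ) P (fun x => x n) (fun x => x (n + 1)))
    {m n : ℕ} (hmn : m < n) : IsOptimalPair μt v m n P (fun x => x m) (fun x => x n) := by
  induction n, hmn using Nat.le_induction with
  | base => exact hP m
  | succ n hmn ih =>
    exact (IsOptimalPair.trans hray (by exact_mod_cast hmn) (by exact_mod_cast n.lt_succ_self)
      (measurable_pi_apply m) (measurable_pi_apply n) (measurable_pi_apply (n + 1)) ih (hP n)).1

lemma ae_dist_eq_of_consecutive
    (hray : ∀ s t : ℝ≥0, Wdist (μt s) (μt t) = v * dist s t) {P : Measure (ℕ → X)}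
    (hP : ∀ n : ℕ, IsOptimalPair μt v n (n + 1 : ℕ) P (fun x => x n) (fun x => x (n + 1))) :
    ∀ᵐ x ∂P, ∀ m n : ℕ, dist (x m) (x n) = dist (m : ℝ) n * dist (x 0) (x 1) := by
  have htri : ∀ᵐ x ∂P, ∀ k m n : ℕ, k < m → m < n →
      ((n : ℝ) - m) * dist (x k) (x m) = (m - k) * dist (x m) (x n) ∧
      dist (x k) (x n) = dist (x k) (x m) + dist (x m) (x n) := by
    simp only [ae_all_iff]
    intro k m n hkm hmn
    have h := (IsOptimalPair.trans hray (by exact_mod_cast hkm) (by exact_mod_cast hmn)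
      (measurable_pi_apply k) (measurable_pi_apply m) (measurable_pi_apply n)
      (isOptimalPair_of_consecutive hray hP hkm)
      (isOptimalPair_of_consecutive hray hP hmn)).2
    simpa using h
  filter_upwards [htri] with x hx
  have h0 : ∀ n : ℕ, dist (x 0) (x n) = n * dist (x 0) (x 1) := by
    intro n
    rcases n with - | - | n
    · simp
    · simp
    · obtain ⟨h1, h2⟩ := hx 0 1 (n + 2) (by omega) (by omega)
      push_cast at h1 ⊢
      linarith
  have hlt : ∀ m n : ℕ, m < n → dist (x m) (x n) = ((n : ℝ) - m) * dist (x 0) (x 1) := by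
    intro m n hmn
    rcases m.eq_zero_or_pos with rfl | hm
    · simpa using h0 n
    · have h2 := (hx 0 m n hm hmn).2
      rw [h0 m, h0 n] at h2
      linarith
  intro m n
  rcases lt_trichotomy m n with hmn | rfl | hmn
  · have : (m : ℝ) < n := by exact_mod_cast hmn
    rw [hlt m n hmn, Real.dist_eq, abs_sub_comm, abs_of_pos (sub_pos.2 this)]
  · simp
  · have : (n : ℝ) < m := by exact_mod_cast hmn
    rw [dist_comm, hlt n m hmn, Real.dist_eq, abs_of_pos (sub_pos.2 this)]

/-- The intermediate point of an optimal plan between two times of a geodesic ray of the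
Wasserstein space has the expected law. -/
lemma map_geodesicPoint_of_isOptimalPair [CompleteSpace X] (hX : IsHadamard X)
    (hnb : NonBranching X)
    (hray : ∀ s t : ℝ≥0, Wdist (μt s) (μt t) = v * dist s t) {Ω : Type*} [MeasurableSpace Ω]
    {P : Measure Ω} {x z : Ω → X} (hx : Measurable x) (hz : Measurable z) {t T : ℝ≥0}
    (ht : t < T) (h : IsOptimalPair μt v 0 T P x z) :
    P.map (fun ω => geodesicPoint hX.geodesic (x ω) (z ω) (t / T)) = (μt t).1 := by
  rcases eq_zero_or_pos t with rfl | ht0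
  · simpa [geodesicPoint_zero] using h.map_left
  have := (μt 0).2.1
  have : Nonempty X := nonempty_of_isProbabilityMeasure (μt 0).1
  have := h.isProbabilityMeasure
  obtain ⟨π, hπ⟩ := exists_isOptimalPair hray 0 t
  obtain ⟨σ, hσ⟩ := exists_isOptimalPair hray t T
  have := hπ.isProbabilityMeasure
  have := hσ.isProbabilityMeasure
  have := Measure.isProbabilityMeasure_map (μ := π) measurable_swap.aemeasurable
  obtain ⟨ρ, hρ, hρπ, hρσ⟩ := exists_glue (π.map Prod.swap) σ (by
    rw [Measure.fst, Measure.map_map measurable_fst measurable_swap]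
    exact hπ.map_right.trans hσ.map_left.symm)
  have hy₀ : IsOptimalPair μt v 0 t ρ (fun p : X × X × X => p.2.1) (fun p => p.1) := by
    have hπ' : IsOptimalPair μt v 0 t (π.map Prod.swap) Prod.snd Prod.fst :=
      (isOptimalPair_map_iff measurable_swap measurable_snd measurable_fst).2 hπ
    rw [← hρπ] at hπ'
    exact (isOptimalPair_map_iff (by fun_prop) measurable_snd measurable_fst).1 hπ'
  have hy₁ : IsOptimalPair μt v t T ρ (fun p : X × X × X => p.1) (fun p => p.2.2) := by
    rw [← hρσ] at hσ
    exact (isOptimalPair_map_iff (by fun_prop) measurable_fst measurable_snd).1 hσ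
  obtain ⟨hy, hae⟩ := hy₀.trans hray ht0 ht (by fun_prop) (by fun_prop) (by fun_prop) hy₁
  have htT : (t : ℝ) < T := ht
  have hT : (0 : ℝ) < T := lt_of_le_of_lt t.2 htT
  have htI : (t / T : ℝ) ∈ Icc (0 : ℝ) 1 := ⟨by positivity, (div_le_one hT).2 htT.le⟩
  have hmap := map_eq_of_isOptimalPair hX hnb hray (ι := Unit) (r := fun _ => 0) (s := T)
    (fun _ => ht0.trans ht) (x := fun _ => x) (y := z) (x' := fun _ (p : X × X × X) => p.2.1)
    (y' := fun p => p.2.2) (fun _ => hx) (fun _ => by fun_prop) hz (by fun_prop) h.map_right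
    hy.map_right (fun _ => h) (fun _ => hy)
  have hg : Measurable fun q : X × (Unit → X) =>
      geodesicPoint hX.geodesic (q.2 ()) q.1 (t / T) :=
    (hX.continuous_geodesicPoint htI).measurable.comp
      (f := fun q : X × (Unit → X) => (q.2 (), q.1))
      (((measurable_pi_apply ()).comp measurable_snd).prodMk measurable_fst)
  have hmap' := congrArg (Measure.map fun q : X × (Unit → X) =>
      geodesicPoint hX.geodesic (q.2 ()) q.1 (t / T)) hmap
  rw [Measure.map_map hg (by fun_prop), Measure.map_map hg (by fun_prop)] at hmap'
  refine hmap'.trans ((Measure.map_congr ?_).trans hy₀.map_right)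
  filter_upwards [hae] with p ⟨h1, h2⟩
  refine (hX.eq_geodesicPoint htI ?_ ?_).symm
  · rw [NNReal.coe_zero, sub_zero] at h1
    rw [h2]
    field_simp
    linarith
  · rw [NNReal.coe_zero, sub_zero] at h1
    rw [h2]
    field_simp
    linarith

lemma measurable_rayOfSeq (hX : IsHadamard X) :
    Measurable (rayOfSeq hX : (ℕ → X) → RaySpace X) := by
  classical
  have hS : MeasurableSet {x : ℕ → X |
      ∀ m n : ℕ, dist (x m) (x n) = dist (m : ℝ) n * dist (x 0) (x 1)} := by
    simp only [ofPred_forall]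
    exact MeasurableSet.iInter fun m => MeasurableSet.iInter fun n =>
      measurableSet_eq_fun (by fun_prop) (by fun_prop)
  refine Measurable.subtype_mk (f := fun x => (rayOfSeq hX x).1)
    (measurable_pi_lambda _ fun t => ?_)
  have hseq : Measurable fun x : ℕ → X => seqRay hX.geodesic x t :=
    (hX.continuous_geodesicPoint (div_floor_add_one_mem_Icc t)).measurable.comp
      (f := fun x : ℕ → X => (x 0, x (⌊t⌋₊ + 1)))
      ((measurable_pi_apply 0).prodMk (measurable_pi_apply (⌊t⌋₊ + 1)))
  have hite : Measurable fun x : ℕ → X =>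
      if ∀ m n : ℕ, dist (x m) (x n) = dist (m : ℝ) n * dist (x 0) (x 1) then
        seqRay hX.geodesic x t else x 0 :=
    Measurable.ite hS hseq (measurable_pi_apply 0)
  convert hite using 2 with x
  rw [rayOfSeq]
  split_ifs <;> rfl

lemma exists_displacement_interpolation [CompleteSpace X] (hX : IsHadamard X) (hnb : NonBranching X)
    (hray : ∀ s t : ℝ≥0, Wdist (μt s) (μt t) = v * dist s t) :
    ∃ μ : Measure (RaySpace X), IsProbabilityMeasure μ ∧
      ∀ t : ℝ≥0, μ.map (rayEval t) = (μt t).1 := by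
  obtain ⟨P, hP, hopt⟩ := exists_isOptimalPair_consecutive hray
  have hmeas := measurable_rayOfSeq hX
  refine ⟨P.map (rayOfSeq hX), Measure.isProbabilityMeasure_map hmeas.aemeasurable, fun t => ?_⟩
  rw [Measure.map_map (measurable_rayEval t) hmeas,
    ← map_geodesicPoint_of_isOptimalPair hX hnb hray (measurable_pi_apply 0)
      (measurable_pi_apply (⌊t⌋₊ + 1)) (by exact_mod_cast Nat.lt_floor_add_one t)
      (by simpa using isOptimalPair_of_consecutive hray hopt (Nat.succ_pos ⌊t⌋₊))]
  refine Measure.map_congr ?_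
  filter_upwards [ae_dist_eq_of_consecutive hray hopt] with x hx
  exact rayEval_rayOfSeq hX hx t

end Existence

/-- **Statement 6.** In a non-branching Hadamard space, every geodesic ray of `W₂(X)`
admits a unique displacement interpolation. -/
theorem displacement_interpolation_unique
    (X : Type*) [MetricSpace X] [MeasurableSpace X] [BorelSpace X] (hX : IsHadamard X)
    (hnb : NonBranching X)
    (v : ℝ) (hv : 0 ≤ v) (μt : ℝ≥0 → W2Space X)
    (hray : ∀ s t : ℝ≥0, Wdist (μt s) (μt t) = v * dist s t) :
    ∃! μ : Measure (RaySpace X), IsProbabilityMeasure μ ∧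
      ∀ t : ℝ≥0, μ.map (rayEval t) = (μt t).1 := by
  have := hX.complete
  have := hX.separable
  have := UniformSpace.secondCountable_of_separable X
  obtain ⟨μ, hμ, hμt⟩ := exists_displacement_interpolation hX hnb hray
  exact ⟨μ, ⟨hμ, hμt⟩, fun ν ⟨_, hνt⟩ => displacement_interpolation_ext hX hnb hv hray hνt hμt⟩

end
end

section
/- Let X be a Hadamard space, let (μ_t)_{t∈ℝ} be a complete unit-speed geodesic of W₂(X), and let μ be a displacement interpolation of it (a probability measure on complete geodesics of X with (e_t)_#μ = μ_t for all t ∈ ℝ). Then μ is concentrated on the set of unit-speed complete geodesics of X. -/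
open MeasureTheory Filter Set Topology
open scoped NNReal ENNReal

noncomputable section


/-! ## Second moments and transport costs -/

lemma lintegral_ofReal_sq_eq_eLpNorm_sq {Ω : Type*} [MeasurableSpace Ω] (μ : Measure Ω)
    {f : Ω → ℝ} (hf : ∀ x, 0 ≤ f x) :
    ∫⁻ x, ENNReal.ofReal (f x) ^ 2 ∂μ = eLpNorm f 2 μ ^ 2 := by
  have h := eLpNorm_nnreal_pow_eq_lintegral (f := f) (μ := μ) (p := 2) two_ne_zero
  simp only [NNReal.coe_ofNat, ENNReal.rpow_ofNat, ENNReal.coe_ofNat] at h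
  rw [h]
  exact lintegral_congr fun x => by rw [Real.enorm_of_nonneg (hf x)]

lemma integral_sq_eq_toReal_eLpNorm_sq {Ω : Type*} [MeasurableSpace Ω] {μ : Measure Ω}
    {f : Ω → ℝ} (hf : MemLp f 2 μ) :
    ∫ x, f x ^ 2 ∂μ = (eLpNorm f 2 μ).toReal ^ 2 := by
  have h0 : 0 ≤ ∫ x, f x ^ 2 ∂μ := integral_nonneg fun x => sq_nonneg _
  rw [hf.eLpNorm_eq_integral_rpow_norm two_ne_zero ENNReal.ofNat_ne_top]
  simp only [ENNReal.toReal_ofNat, Real.rpow_ofNat, Real.norm_eq_abs, sq_abs]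
  rw [ENNReal.toReal_ofReal (by positivity), ← Real.rpow_natCast, ← Real.rpow_mul h0]
  norm_num

/-- A random variable of `L²` norm at most one whose sum with an independent copy has `L²` norm
at least two is almost surely equal to one. -/
lemma ae_eq_one_of_eLpNorm_add_indep_copy {Ω : Type*} [MeasurableSpace Ω] {μ : Measure Ω}
    [IsProbabilityMeasure μ] {v : Ω → ℝ} (hv : AEStronglyMeasurable v μ) (hv0 : ∀ x, 0 ≤ v x)
    (h1 : eLpNorm v 2 μ ≤ 1)
    (h2 : 2 ≤ eLpNorm (fun p : Ω × Ω => v p.1 + v p.2) 2 (μ.prod μ)) :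
    ∀ᵐ x ∂μ, v x = 1 := by
  have hL : MemLp v 2 μ := ⟨hv, h1.trans_lt ENNReal.one_lt_top⟩
  have hLf : MemLp (fun p : Ω × Ω => v p.1) 2 (μ.prod μ) :=
    hL.comp_measurePreserving measurePreserving_fst
  have hLs : MemLp (fun p : Ω × Ω => v p.2) 2 (μ.prod μ) :=
    hL.comp_measurePreserving measurePreserving_snd
  have hLa : MemLp (fun p : Ω × Ω => v p.1 + v p.2) 2 (μ.prod μ) := hLf.add hLs
  have hi : Integrable v μ := hL.integrable one_le_two
  have hsq : ∫ x, v x ^ 2 ∂μ ≤ 1 := by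
    rw [integral_sq_eq_toReal_eLpNorm_sq hL]
    have := ENNReal.toReal_mono ENNReal.one_ne_top h1
    rw [ENNReal.toReal_one] at this
    exact pow_le_one₀ ENNReal.toReal_nonneg this
  have hadd : 4 ≤ ∫ p : Ω × Ω, (v p.1 + v p.2) ^ 2 ∂μ.prod μ := by
    rw [integral_sq_eq_toReal_eLpNorm_sq hLa]
    have := ENNReal.toReal_mono hLa.2.ne h2
    rw [ENNReal.toReal_ofNat] at this
    nlinarith
  have hexp : ∫ p : Ω × Ω, (v p.1 + v p.2) ^ 2 ∂μ.prod μ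
      = 2 * ∫ x, v x ^ 2 ∂μ + 2 * (∫ x, v x ∂μ) ^ 2 := by
    have e : (fun p : Ω × Ω => (v p.1 + v p.2) ^ 2)
        = fun p => v p.1 ^ 2 + v p.2 ^ 2 + 2 * (v p.1 * v p.2) := by
      funext p; ring
    have hq : Integrable (fun p : Ω × Ω => v p.1 ^ 2 + v p.2 ^ 2) (μ.prod μ) :=
      hLf.integrable_sq.add hLs.integrable_sq
    rw [e, integral_add hq ((hi.mul_prod hi).const_mul 2), integral_add hLf.integrable_sq hLs.integrable_sq,
      integral_const_mul, integral_prod_mul, integral_fun_fst (fun x => v x ^ 2),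
      integral_fun_snd (fun x => v x ^ 2)]
    simp only [probReal_univ, one_smul]
    ring
  have hm : 1 ≤ ∫ x, v x ∂μ := by
    have h0 : 0 ≤ ∫ x, v x ∂μ := integral_nonneg hv0
    nlinarith
  have hsub : MemLp (fun x => v x - 1) 2 μ := hL.sub (memLp_const 1)
  have hvar : ∫ x, (v x - 1) ^ 2 ∂μ = 0 := by
    refine le_antisymm ?_ (integral_nonneg fun x => sq_nonneg _)
    have e : (fun x => (v x - 1) ^ 2) = fun x => v x ^ 2 - 2 * v x + 1 := by
      funext x; ring
    have hq : Integrable (fun x => v x ^ 2 - 2 * v x) μ :=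
      hL.integrable_sq.sub (hi.const_mul 2)
    rw [e, integral_add hq (integrable_const _),
      integral_sub hL.integrable_sq (hi.const_mul 2), integral_const_mul]
    simp only [integral_const, probReal_univ, one_smul]
    linarith
  rw [integral_eq_zero_iff_of_nonneg (fun x => sq_nonneg _) hsub.integrable_sq] at hvar
  filter_upwards [hvar] with x hx
  have : v x - 1 = 0 := pow_eq_zero_iff two_ne_zero |>.1 hx
  linarith

lemma le_of_forall_pos_mul_le_add_mul {a b C : ℝ} (h : ∀ t : ℝ, 0 < t → a * t ≤ C + b * t) :
    a ≤ b := by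
  by_contra! hab
  have hC : 0 < |C| + 1 := by positivity
  have := h ((|C| + 1) / (a - b)) (div_pos hC (sub_pos.2 hab))
  have e : (a - b) * ((|C| + 1) / (a - b)) = |C| + 1 := mul_div_cancel₀ _ (sub_pos.2 hab).ne'
  linarith [le_abs_self C]

lemma W2cost_eq_of_Wdist_eq {Y : Type*} [MetricSpace Y] [MeasurableSpace Y] {μ ν : W2Space Y}
    {r : ℝ} (hr : 0 < r) (h : Wdist μ ν = r) : W2cost μ.1 ν.1 = ENNReal.ofReal r ^ 2 := by
  have hsq : (W2cost μ.1 ν.1).toReal = r ^ 2 := (Real.sqrt_eq_iff_eq_sq ENNReal.toReal_nonneg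
    hr.le).1 h
  have hfin : W2cost μ.1 ν.1 ≠ ⊤ := by
    intro htop
    rw [htop, ENNReal.toReal_top] at hsq
    exact (pow_pos hr 2).ne hsq
  rw [← ENNReal.ofReal_toReal hfin, hsq, ENNReal.ofReal_pow hr.le]

section

variable {Y : Type*} [MetricSpace Y] [MeasurableSpace Y] [BorelSpace Y]
  [SecondCountableTopology Y]

lemma eLpNorm_dist_le_of_W2cost_lt {μ ν : Measure Y} {c : ℝ}
    (h : W2cost μ ν < ENNReal.ofReal c ^ 2) (x₀ : Y) :
    eLpNorm (fun y => dist x₀ y) 2 ν ≤ eLpNorm (fun y => dist x₀ y) 2 μ + ENNReal.ofReal c := by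
  simp only [W2cost, iInf_lt_iff] at h
  obtain ⟨π, ⟨rfl, rfl⟩, hπ⟩ := h
  rw [lintegral_ofReal_sq_eq_eLpNorm_sq π fun p => dist_nonneg] at hπ
  have hd : Measurable fun y : Y => dist x₀ y := by fun_prop
  rw [eLpNorm_map_measure hd.aestronglyMeasurable measurable_snd.aemeasurable,
    eLpNorm_map_measure hd.aestronglyMeasurable measurable_fst.aemeasurable]
  have h1 : Measurable fun p : Y × Y => dist x₀ p.1 := by fun_prop
  have h2 : Measurable fun p : Y × Y => dist p.1 p.2 := by fun_prop
  have htri : eLpNorm (fun p : Y × Y => dist x₀ p.2) 2 π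
      ≤ eLpNorm ((fun p : Y × Y => dist x₀ p.1) + fun p => dist p.1 p.2) 2 π :=
    eLpNorm_mono_real fun p => by
      rw [Real.norm_of_nonneg dist_nonneg]
      exact dist_triangle _ _ _
  refine htri.trans ((eLpNorm_add_le h1.aestronglyMeasurable h2.aestronglyMeasurable
    one_le_two).trans (add_le_add le_rfl ?_))
  exact ((ENNReal.pow_lt_pow_left_iff two_ne_zero).1 hπ).le

lemma W2cost_map_le_eLpNorm_prod {Ω : Type*} [MeasurableSpace Ω] (μ : Measure Ω)
    [IsProbabilityMeasure μ] {f g : Ω → Y} (hf : Measurable f) (hg : Measurable g) :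
    W2cost (μ.map f) (μ.map g)
      ≤ eLpNorm (fun p : Ω × Ω => dist (f p.1) (g p.2)) 2 (μ.prod μ) ^ 2 := by
  have hfg : Measurable (Prod.map f g) := hf.prodMap hg
  have hd : Measurable fun p : Y × Y => ENNReal.ofReal (dist p.1 p.2) ^ 2 := by fun_prop
  have hc : IsCoupling ((μ.prod μ).map (Prod.map f g)) (μ.map f) (μ.map g) := by
    constructor
    · rw [Measure.map_map measurable_fst hfg, show Prod.fst ∘ Prod.map f g = f ∘ Prod.fst from rfl,
        ← Measure.map_map hf measurable_fst, measurePreserving_fst.map_eq]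
    · rw [Measure.map_map measurable_snd hfg, show Prod.snd ∘ Prod.map f g = g ∘ Prod.snd from rfl,
        ← Measure.map_map hg measurable_snd, measurePreserving_snd.map_eq]
  have hle : W2cost (μ.map f) (μ.map g) ≤
      ∫⁻ p, ENNReal.ofReal (dist p.1 p.2) ^ 2 ∂(μ.prod μ).map (Prod.map f g) :=
    iInf_le_of_le _ (iInf_le _ hc)
  refine hle.trans_eq ?_
  rw [lintegral_map hd hfg]
  exact lintegral_ofReal_sq_eq_eLpNorm_sq _ fun p => dist_nonneg

end

/-! ## The speed of a complete geodesic -/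

/-- The speed of a complete geodesic. -/
def lineSpeed {X : Type*} [MetricSpace X] (γ : GeoLine X) : ℝ := dist (γ.1 0) (γ.1 1)

lemma dist_eq_lineSpeed_mul {X : Type*} [MetricSpace X] (γ : GeoLine X) (s t : ℝ) :
    dist (γ.1 s) (γ.1 t) = lineSpeed γ * |s - t| := by
  obtain ⟨v, -, hv⟩ := γ.2
  have h : lineSpeed γ = v := by simp [lineSpeed, hv]
  rw [h, hv]

lemma measurable_lineEval {X : Type*} [MetricSpace X] [MeasurableSpace X] (t : ℝ) :
    Measurable fun γ : GeoLine X => γ.1 t :=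
  (measurable_pi_apply t).comp measurable_subtype_coe

lemma measurable_lineSpeed {X : Type*} [MetricSpace X] [MeasurableSpace X] [BorelSpace X]
    [SecondCountableTopology X] : Measurable (lineSpeed : GeoLine X → ℝ) :=
  (measurable_lineEval 0).dist (measurable_lineEval 1)

lemma eLpNorm_lineSpeed_mul {X : Type*} [MetricSpace X] [MeasurableSpace X]
    (μ : Measure (GeoLine X)) {t : ℝ} (ht : 0 ≤ t) :
    eLpNorm (fun γ => lineSpeed γ * t) 2 μ = eLpNorm lineSpeed 2 μ * ENNReal.ofReal t := by
  have e : (fun γ : GeoLine X => lineSpeed γ * t) = t • lineSpeed := by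
    funext γ; simp [mul_comm]
  rw [e, eLpNorm_const_smul, Real.enorm_of_nonneg ht, mul_comm]

section

variable {X : Type*} [MetricSpace X] [MeasurableSpace X] [BorelSpace X]
  [SecondCountableTopology X]

/-- If the time marginals stay at distance at most `t` from the initial one, up to an additive
constant, then the mean square of the speed is at most one. -/
lemma eLpNorm_lineSpeed_le_one (μ : Measure (GeoLine X)) (x₀ : X) (A : ℝ≥0)
    (h0 : eLpNorm (fun γ : GeoLine X => dist x₀ (γ.1 0)) 2 μ ≤ A)
    (ht : ∀ t : ℝ, 0 < t →
      eLpNorm (fun γ : GeoLine X => dist x₀ (γ.1 t)) 2 μ ≤ A + ENNReal.ofReal (t + 1)) :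
    eLpNorm lineSpeed 2 μ ≤ 1 := by
  have hm : ∀ t : ℝ, AEStronglyMeasurable (fun γ : GeoLine X => dist x₀ (γ.1 t)) μ := fun t =>
    (measurable_const.dist (measurable_lineEval t)).aestronglyMeasurable
  have key : ∀ t : ℝ, 0 < t →
      eLpNorm lineSpeed 2 μ * ENNReal.ofReal t ≤ ENNReal.ofReal (2 * A + 1 + 1 * t) := by
    intro t htpos
    calc eLpNorm lineSpeed 2 μ * ENNReal.ofReal t
        = eLpNorm (fun γ => lineSpeed γ * t) 2 μ := (eLpNorm_lineSpeed_mul μ htpos.le).symm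
      _ ≤ eLpNorm ((fun γ : GeoLine X => dist x₀ (γ.1 0)) + fun γ => dist x₀ (γ.1 t)) 2 μ := by
        refine eLpNorm_mono_real fun γ => ?_
        have h := dist_eq_lineSpeed_mul γ 0 t
        rw [zero_sub, abs_neg, abs_of_pos htpos] at h
        rw [← h, Real.norm_of_nonneg dist_nonneg]
        exact dist_triangle_left _ _ _
      _ ≤ _ := eLpNorm_add_le (hm 0) (hm t) one_le_two
      _ ≤ A + (A + ENNReal.ofReal (t + 1)) := add_le_add h0 (ht t htpos)
      _ = ENNReal.ofReal (2 * A + 1 + 1 * t) := by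
        rw [← ENNReal.ofReal_coe_nnreal, ← ENNReal.ofReal_add (by positivity) (by positivity),
          ← ENNReal.ofReal_add (by positivity) (by positivity)]
        congr 1; ring
  have hfin : eLpNorm lineSpeed 2 μ ≠ ⊤ := by
    have h := key 1 one_pos
    rw [ENNReal.ofReal_one, mul_one] at h
    exact (h.trans_lt ENNReal.ofReal_lt_top).ne
  rw [← ENNReal.ofReal_toReal hfin, ENNReal.ofReal_le_one]
  refine le_of_forall_pos_mul_le_add_mul (C := 2 * A + 1) fun t htpos => ?_
  have h := ENNReal.toReal_mono ENNReal.ofReal_ne_top (key t htpos)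
  rwa [ENNReal.toReal_mul, ENNReal.toReal_ofReal htpos.le,
    ENNReal.toReal_ofReal (by positivity)] at h

/-- If the marginals at times `-t` and `t` are at distance at least `2 t`, then the sum of the
speeds of two independent geodesics has mean square at least four. -/
lemma two_le_eLpNorm_lineSpeed_add (μ : Measure (GeoLine X)) [IsProbabilityMeasure μ] (x₀ : X)
    (A : ℝ≥0) (h0 : eLpNorm (fun γ : GeoLine X => dist x₀ (γ.1 0)) 2 μ ≤ A)
    (ht : ∀ t : ℝ, 0 < t → ENNReal.ofReal (2 * t) ^ 2 ≤
      W2cost (μ.map fun γ : GeoLine X => γ.1 (-t)) (μ.map fun γ : GeoLine X => γ.1 t)) :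
    2 ≤ eLpNorm (fun p : GeoLine X × GeoLine X => lineSpeed p.1 + lineSpeed p.2) 2
      (μ.prod μ) := by
  set S := eLpNorm (fun p : GeoLine X × GeoLine X => lineSpeed p.1 + lineSpeed p.2) 2 (μ.prod μ)
  have hd : Measurable fun γ : GeoLine X => dist x₀ (γ.1 0) :=
    measurable_const.dist (measurable_lineEval 0)
  have hdf : Measurable fun p : GeoLine X × GeoLine X => dist x₀ (p.1.1 0) :=
    hd.comp measurable_fst
  have hds : Measurable fun p : GeoLine X × GeoLine X => dist x₀ (p.2.1 0) :=
    hd.comp measurable_snd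
  have hs : Measurable fun p : GeoLine X × GeoLine X => lineSpeed p.1 + lineSpeed p.2 :=
    (measurable_lineSpeed.comp measurable_fst).add (measurable_lineSpeed.comp measurable_snd)
  have hAf : eLpNorm (fun p : GeoLine X × GeoLine X => dist x₀ (p.1.1 0)) 2 (μ.prod μ) ≤ A :=
    (eLpNorm_comp_measurePreserving hd.aestronglyMeasurable measurePreserving_fst).trans_le h0
  have hAs : eLpNorm (fun p : GeoLine X × GeoLine X => dist x₀ (p.2.1 0)) 2 (μ.prod μ) ≤ A :=
    (eLpNorm_comp_measurePreserving hd.aestronglyMeasurable measurePreserving_snd).trans_le h0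
  have key : ∀ t : ℝ, 0 < t → ENNReal.ofReal (2 * t) ≤ ENNReal.ofReal t * S + (A + A) := by
    intro t htpos
    have hcost := (ht t htpos).trans
      (W2cost_map_le_eLpNorm_prod μ (measurable_lineEval (-t)) (measurable_lineEval t))
    refine ((ENNReal.pow_le_pow_left_iff two_ne_zero).1 hcost).trans ?_
    calc eLpNorm (fun p : GeoLine X × GeoLine X => dist (p.1.1 (-t)) (p.2.1 t)) 2 (μ.prod μ)
        ≤ eLpNorm ((t • fun p : GeoLine X × GeoLine X => lineSpeed p.1 + lineSpeed p.2)
            + ((fun p => dist x₀ (p.1.1 0)) + fun p => dist x₀ (p.2.1 0))) 2 (μ.prod μ) := by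
          refine eLpNorm_mono_real fun p => ?_
          rw [Real.norm_of_nonneg dist_nonneg]
          have h1 := dist_eq_lineSpeed_mul p.1 (-t) 0
          have h2 := dist_eq_lineSpeed_mul p.2 0 t
          rw [sub_zero, abs_neg, abs_of_pos htpos] at h1
          rw [zero_sub, abs_neg, abs_of_pos htpos] at h2
          have h3 := dist_triangle4 (p.1.1 (-t)) (p.1.1 0) (p.2.1 0) (p.2.1 t)
          have h4 := dist_triangle_left (p.1.1 0) (p.2.1 0) x₀
          simp only [Pi.add_apply, Pi.smul_apply, smul_eq_mul]
          linarith
      _ ≤ ENNReal.ofReal t * S + (A + A) := by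
          refine (eLpNorm_add_le (hs.const_smul t).aestronglyMeasurable
            (hdf.add hds).aestronglyMeasurable one_le_two).trans (add_le_add ?_ ?_)
          · rw [eLpNorm_const_smul, Real.enorm_of_nonneg htpos.le]
          · exact (eLpNorm_add_le hdf.aestronglyMeasurable hds.aestronglyMeasurable
              one_le_two).trans (add_le_add hAf hAs)
  by_cases hfin : S = ⊤
  · simp [hfin]
  rw [← ENNReal.ofReal_toReal hfin, ← ENNReal.ofReal_ofNat 2]
  refine ENNReal.ofReal_le_ofReal (le_of_forall_pos_mul_le_add_mul (C := A + A) fun t htpos => ?_)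
  have hr : ENNReal.ofReal t * S + (A + A) ≠ ⊤ := by finiteness
  have h := ENNReal.toReal_mono hr (key t htpos)
  rw [ENNReal.toReal_ofReal (by positivity), ENNReal.toReal_add (by finiteness) (by finiteness),
    ENNReal.toReal_mul, ENNReal.toReal_ofReal htpos.le,
    ENNReal.toReal_add (by finiteness) (by finiteness), ENNReal.coe_toReal] at h
  linarith

end

/-- **Statement 8.** A displacement interpolation of a complete unit-speed geodesic of
`W₂(X)` is concentrated on the set of unit-speed complete geodesics of `X`. -/
theorem interpolation_of_complete_geodesic_unit_speed
    (X : Type*) [MetricSpace X] [MeasurableSpace X] [BorelSpace X] (hX : IsHadamard X)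
    (μt : ℝ → W2Space X) (hgeo : ∀ s t : ℝ, Wdist (μt s) (μt t) = |s - t|)
    (μ : Measure (GeoLine X)) (hp : IsProbabilityMeasure μ)
    (hdisp : ∀ t : ℝ, μ.map (fun γ : GeoLine X => γ.1 t) = (μt t).1) :
    μ {γ : GeoLine X | ∀ s t : ℝ, dist (γ.1 s) (γ.1 t) = |s - t|} = 1 := by
  have := hX.separable
  have : SecondCountableTopology X := UniformSpace.secondCountable_of_separable X
  obtain ⟨x₀, hx₀⟩ := (μt 0).2.2
  have hd : Measurable fun y : X => dist x₀ y := by fun_prop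
  have hmarg : ∀ t : ℝ, eLpNorm (fun γ : GeoLine X => dist x₀ (γ.1 t)) 2 μ
      = eLpNorm (fun y => dist x₀ y) 2 (μt t).1 := fun t => by
    rw [← hdisp t, eLpNorm_map_measure hd.aestronglyMeasurable (measurable_lineEval t).aemeasurable]
    rfl
  rw [lintegral_ofReal_sq_eq_eLpNorm_sq _ fun x => dist_nonneg,
    ENNReal.pow_lt_top_iff, or_iff_left two_ne_zero] at hx₀
  obtain ⟨A, hA⟩ := WithTop.ne_top_iff_exists.1 hx₀.ne
  change (A : ℝ≥0∞) = _ at hA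
  have h0 : eLpNorm (fun γ : GeoLine X => dist x₀ (γ.1 0)) 2 μ ≤ A := by rw [hmarg, ← hA]
  have hle : eLpNorm lineSpeed 2 μ ≤ 1 := by
    refine eLpNorm_lineSpeed_le_one μ x₀ A h0 fun t ht => ?_
    rw [hmarg, hA]
    refine eLpNorm_dist_le_of_W2cost_lt ?_ x₀
    rw [W2cost_eq_of_Wdist_eq ht (by rw [hgeo, zero_sub, abs_neg, abs_of_pos ht])]
    exact (ENNReal.pow_lt_pow_left_iff two_ne_zero).2
      ((ENNReal.ofReal_lt_ofReal_iff (by positivity)).2 (lt_add_one t))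
  have hge := two_le_eLpNorm_lineSpeed_add μ x₀ A h0 fun t ht => by
    rw [hdisp, hdisp, W2cost_eq_of_Wdist_eq (r := 2 * t) (by positivity)]
    rw [hgeo, show -t - t = -(2 * t) by ring, abs_neg, abs_of_pos (by positivity)]
  have hae := ae_eq_one_of_eLpNorm_add_indep_copy measurable_lineSpeed.aestronglyMeasurable
    (fun γ => dist_nonneg) hle hge
  rw [← measure_univ (μ := μ)]
  refine measure_congr (eventuallyEq_univ.2 ?_)
  filter_upwards [hae] with γ hγ s t
  rw [dist_eq_lineSpeed_mul, hγ, one_mul]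

end
end

section
/- Let X be a Hadamard space which is a visibility space. Then the space P(∂X) of Borel probability measures on ∂X (viewed as the level {speed 1} inside the cone c∂X), endowed with the Wasserstein metric W_∞ built from the cost d_∞², contains no non-constant rectifiable curve. -/
open MeasureTheory Filter Set Topology
open scoped NNReal ENNReal

noncomputable section


/-- On a visibility space, rays that are not asymptotic are at asymptotic distance `2`. -/
lemma IsVisibility.dInfty_eq_two {X : Type*} [MetricSpace X] (hvis : IsVisibility X)
    (α ω : UnitRay X) (h : ¬ AsymptoticMaps dist α.1 ω.1) : dInfty α.1 ω.1 = 2 := by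
  obtain ⟨g, hg, ⟨C, hC⟩, ⟨C', hC'⟩⟩ := hvis α ω h
  have hline : ∀ t : ℝ≥0, dist (g (-(t : ℝ))) (g t) = 2 * t := by
    intro t
    rw [hg, show -(t : ℝ) - t = -(2 * t) by ring, abs_neg, abs_of_nonneg (by positivity)]
  have hzero : ∀ D : ℝ, Tendsto (fun t : ℝ≥0 => 2 + D / (t : ℝ)) atTop (𝓝 2) := fun D => by
    have := (tendsto_const_nhds (x := D)).div_atTop (NNReal.tendsto_coe_atTop.2 tendsto_id)
    simpa using (tendsto_const_nhds (x := (2 : ℝ))).add this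
  refine Tendsto.limsup_eq
    (tendsto_of_tendsto_of_tendsto_of_le_of_le' (hzero (-(C + C'))) (hzero (C + C')) ?_ ?_)
  · filter_upwards [eventually_gt_atTop 0] with t ht
    have ht' : (0 : ℝ) < t := by exact_mod_cast ht
    rw [le_div_iff₀ ht', add_mul, div_mul_cancel₀ _ ht'.ne']
    have h1 := dist_triangle4 (g (-(t : ℝ))) (α.1 t) (ω.1 t) (g t)
    have h2 := hC t
    have h3 := hC' t
    rw [dist_comm] at h3
    linarith [hline t]
  · filter_upwards [eventually_gt_atTop 0] with t ht
    have ht' : (0 : ℝ) < t := by exact_mod_cast ht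
    rw [div_le_iff₀ ht', add_mul, div_mul_cancel₀ _ ht'.ne']
    have h1 := dist_triangle4 (α.1 t) (g (-(t : ℝ))) (g t) (ω.1 t)
    have h2 := hC t
    have h3 := hC' t
    rw [dist_comm] at h2
    linarith [hline t]

lemma boundaryDist_self {X : Type*} [MetricSpace X] (ξ : Boundary X) :
    boundaryDist ξ ξ = 0 := by
  simp [boundaryDist, dInfty]

lemma IsVisibility.boundaryDist_eq_two {X : Type*} [MetricSpace X] (hvis : IsVisibility X)
    {ξ ζ : Boundary X} (h : ξ ≠ ζ) : boundaryDist ξ ζ = 2 := by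
  refine hvis.dInfty_eq_two _ _ fun hasym => h ?_
  rw [← Quotient.out_eq ξ, ← Quotient.out_eq ζ]
  exact Quotient.sound hasym

lemma coneDist_level_one {X : Type*} [MetricSpace X] (ξ ζ : Boundary X) :
    coneDist (coneMk ξ 1) (coneMk ζ 1) = |boundaryDist ξ ζ| := by
  change Real.sqrt ((((1 : ℝ≥0) : ℝ) - ((1 : ℝ≥0) : ℝ)) ^ 2
    + ((1 : ℝ≥0) : ℝ) * ((1 : ℝ≥0) : ℝ) * boundaryDist ξ ζ ^ 2) = _
  simp [Real.sqrt_sq_eq_abs]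

lemma IsVisibility.sq_coneDist_level_one {X : Type*} [MetricSpace X] (hvis : IsVisibility X)
    {ξ ζ : Boundary X} (h : ξ ≠ ζ) :
    ENNReal.ofReal (coneDist (coneMk ξ 1) (coneMk ζ 1)) ^ 2 = 4 := by
  rw [coneDist_level_one, hvis.boundaryDist_eq_two h, abs_two, ← ENNReal.ofReal_pow two_pos.le]
  norm_num

lemma IsVisibility.sq_coneDist_level_one_le {X : Type*} [MetricSpace X] (hvis : IsVisibility X)
    (ξ ζ : Boundary X) :
    ENNReal.ofReal (coneDist (coneMk ξ 1) (coneMk ζ 1)) ^ 2 ≤ 4 := by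
  rcases eq_or_ne ξ ζ with rfl | h
  · simp [coneDist_level_one, boundaryDist_self]
  · exact (hvis.sq_coneDist_level_one h).le

/-- The optimal transport cost dominates four times the total variation. -/
lemma IsVisibility.four_mul_sub_le_cost {X : Type*} [MetricSpace X] (hvis : IsVisibility X)
    (m m' : Measure (Boundary X)) {A : Set (Boundary X)} (hA : MeasurableSet A) :
    4 * (m A - m' A) ≤ ⨅ (π : Measure (Boundary X × Boundary X)) (_ : IsCoupling π m m'),
      ∫⁻ p, ENNReal.ofReal (coneDist (coneMk p.1 1) (coneMk p.2 1)) ^ 2 ∂π := by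
  refine le_iInf₂ fun π hπ => ?_
  have hsub : m A - m' A ≤ π (A ×ˢ Aᶜ) := by
    rw [tsub_le_iff_right, ← hπ.1, ← hπ.2, Measure.map_apply measurable_fst hA,
      Measure.map_apply measurable_snd hA]
    refine (measure_mono fun p hp => ?_).trans (measure_union_le _ _)
    by_cases h : p.2 ∈ A
    · exact Or.inr h
    · exact Or.inl ⟨hp, h⟩
  calc 4 * (m A - m' A) ≤ 4 * π (A ×ˢ Aᶜ) := by gcongr
    _ = ∫⁻ p, (A ×ˢ Aᶜ).indicator (fun _ => 4) p ∂π := by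
      rw [lintegral_indicator_const (hA.prod hA.compl)]
    _ ≤ _ := by
      refine lintegral_mono fun p => ?_
      by_cases hp : p ∈ A ×ˢ Aᶜ
      · rw [indicator_of_mem hp]
        have hne : p.1 ≠ p.2 := fun h => hp.2 (h ▸ hp.1)
        exact (hvis.sq_coneDist_level_one hne).ge
      · simp [indicator_of_notMem hp]

lemma IsVisibility.cost_lt_top {X : Type*} [MetricSpace X] (hvis : IsVisibility X)
    (m m' : Measure (Boundary X)) [IsProbabilityMeasure m] [IsProbabilityMeasure m'] :
    (⨅ (π : Measure (Boundary X × Boundary X)) (_ : IsCoupling π m m'),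
      ∫⁻ p, ENNReal.ofReal (coneDist (coneMk p.1 1) (coneMk p.2 1)) ^ 2 ∂π) < ⊤ := by
  have hπ : IsCoupling (m.prod m') m m' :=
    ⟨by simp [Measure.map_fst_prod], by simp [Measure.map_snd_prod]⟩
  have hle : ∫⁻ p, ENNReal.ofReal (coneDist (coneMk p.1 1) (coneMk p.2 1)) ^ 2 ∂(m.prod m')
      ≤ ∫⁻ _, 4 ∂(m.prod m') :=
    lintegral_mono fun p => hvis.sq_coneDist_level_one_le p.1 p.2
  have htop : ∫⁻ _, 4 ∂(m.prod m') < ⊤ := by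
    rw [lintegral_const, measure_univ, mul_one]
    exact ENNReal.ofNat_lt_top
  exact (iInf₂_le_of_le (m.prod m') hπ hle).trans_lt htop

lemma IsVisibility.four_mul_abs_sub_le_sq_WinftyLevel1 {X : Type*} [MetricSpace X]
    (hvis : IsVisibility X) (m m' : Measure (Boundary X)) [IsProbabilityMeasure m]
    [IsProbabilityMeasure m'] {A : Set (Boundary X)} (hA : MeasurableSet A) :
    4 * |m.real A - m'.real A| ≤ WinftyLevel1 m m' ^ 2 := by
  have key : ∀ B : Set (Boundary X), MeasurableSet B →
      4 * (m.real B - m'.real B) ≤ WinftyLevel1 m m' ^ 2 := by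
    intro B hB
    rw [WinftyLevel1, Real.sq_sqrt ENNReal.toReal_nonneg]
    refine le_trans ?_
      (ENNReal.toReal_mono (hvis.cost_lt_top m m').ne (hvis.four_mul_sub_le_cost m m' hB))
    rw [ENNReal.toReal_mul]
    have h : m.real B - m'.real B ≤ (m B - m' B).toReal :=
      ENNReal.le_toReal_sub (measure_ne_top m' B)
    rw [ENNReal.toReal_ofNat]
    linarith
  have h1 := key A hA
  have h2 := key Aᶜ hA.compl
  rw [probReal_compl_eq_one_sub hA, probReal_compl_eq_one_sub hA] at h2
  rcases abs_cases (m.real A - m'.real A) with h | h <;> linarith [h.1]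

/-- A continuous function whose squareroot variation is dominated by the length of a
rectifiable curve is constant. -/
lemma eq_of_four_mul_abs_sub_le_sq {E : Type*} {d : E → E → ℝ} (hd : ∀ x y, 0 ≤ d x y)
    {c : ℝ → E} {a b : ℝ} (hcont : ContinuousWithRespect d c (Icc a b))
    (hrect : curveLengthWith d c a b < ⊤) {f : E → ℝ}
    (hf : ∀ x y, 4 * |f x - f y| ≤ d x y ^ 2) {s t : ℝ} (hs : s ∈ Icc a b) (ht : t ∈ Icc a b)
    (hst : s ≤ t) : f (c s) = f (c t) := by
  have hfc : ContinuousOn (fun u => f (c u)) (Icc a b) := by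
    rw [Metric.continuousOn_iff]
    intro u hu ε hε
    obtain ⟨δ, hδ, h⟩ := hcont u hu (√ε) (Real.sqrt_pos.2 hε)
    refine ⟨δ, hδ, fun v hv hvu => ?_⟩
    have h1 := pow_lt_pow_left₀ (h v hv hvu) (hd _ _) two_ne_zero
    rw [Real.sq_sqrt hε.le] at h1
    rw [Real.dist_eq]
    linarith [hf (c v) (c u), abs_nonneg (f (c v) - f (c u))]
  have huc := Metric.uniformContinuousOn_iff.1 (isCompact_Icc.uniformContinuousOn_of_continuous hfc)
  set L := (curveLengthWith d c a b).toReal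
  have key : ∀ η : ℝ, 0 < η → |f (c t) - f (c s)| ≤ η * L := by
    intro η hη
    obtain ⟨δ, hδ, h⟩ := huc (η ^ 2) (by positivity)
    obtain ⟨n, hn⟩ := exists_nat_gt ((t - s) / δ)
    have hn0 : (0 : ℝ) < n := lt_of_le_of_lt (div_nonneg (sub_nonneg.2 hst) hδ.le) hn
    have hstep : (t - s) / n < δ := by
      rw [div_lt_iff₀ hδ] at hn
      rw [div_lt_iff₀ hn0]
      linarith
    have hstep0 : 0 ≤ (t - s) / n := div_nonneg (sub_nonneg.2 hst) hn0.le
    set p : ℕ → ℝ := fun i => s + i * ((t - s) / n) with hp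
    have hpn : p n = t := by simp only [hp]; field_simp; ring
    have hp0 : p 0 = s := by simp [hp]
    have hpmono : Monotone p := fun i j hij => by
      simp only [hp]
      gcongr
    have hpmem : ∀ i ≤ n, p i ∈ Icc a b := fun i hi =>
      ⟨hs.1.trans (hp0 ▸ hpmono (Nat.zero_le i)), (hpn ▸ hpmono hi : p i ≤ t).trans ht.2⟩
    have hlen : ∑ i ∈ Finset.range n, d (c (p i)) (c (p (i + 1))) ≤ L := by
      refine (ENNReal.ofReal_le_iff_le_toReal hrect.ne).1 ?_
      rw [ENNReal.ofReal_sum_of_nonneg fun _ _ => hd _ _, Finset.sum_range]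
      exact le_iSup₂_of_le n (fun i : Fin (n + 1) => p i) <| le_iSup₂_of_le
        (fun i j hij => hpmono hij) (fun i => hpmem i (Nat.lt_succ_iff.1 i.2)) le_rfl
    calc |f (c t) - f (c s)|
        = |∑ i ∈ Finset.range n, (f (c (p (i + 1))) - f (c (p i)))| := by
          rw [Finset.sum_range_sub (fun i => f (c (p i))), hpn, hp0]
      _ ≤ ∑ i ∈ Finset.range n, |f (c (p (i + 1))) - f (c (p i))| :=
          Finset.abs_sum_le_sum_abs _ _
      _ ≤ ∑ i ∈ Finset.range n, η * d (c (p i)) (c (p (i + 1))) := by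
          refine Finset.sum_le_sum fun i hi => ?_
          have hi' := Finset.mem_range.1 hi
          have hdist : dist (p i) (p (i + 1)) < δ := by
            rw [Real.dist_eq, show p i - p (i + 1) = -((t - s) / n) by
              simp only [hp]; push_cast; ring, abs_neg, abs_of_nonneg hstep0]
            exact hstep
          have h1 := h (p i) (hpmem i hi'.le) (p (i + 1)) (hpmem _ hi') hdist
          rw [Real.dist_eq] at h1
          have h2 := hf (c (p i)) (c (p (i + 1)))
          rw [abs_sub_comm]
          have h0 := abs_nonneg (f (c (p i)) - f (c (p (i + 1))))
          refine (sq_le_sq₀ h0 (mul_nonneg hη.le (hd _ _))).1 ?_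
          rw [mul_pow, sq |_|]
          exact mul_le_mul h1.le (by linarith) h0 (by positivity)
      _ ≤ η * L := by
          rw [← Finset.mul_sum]
          gcongr
  have hlim : Tendsto (fun η : ℝ => η * L) (𝓝[>] 0) (𝓝 0) := by
    have : Tendsto (fun η : ℝ => η * L) (𝓝 0) (𝓝 (0 * L)) := tendsto_id.mul_const L
    rw [zero_mul] at this
    exact this.mono_left nhdsWithin_le_nhds
  have h0 := ge_of_tendsto hlim (eventually_nhdsWithin_of_forall key)
  exact (sub_eq_zero.1 (abs_nonpos_iff.1 h0)).symm

/-- **Statement 9.** If `X` is a Hadamard visibility space, the space of probability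
measures on `∂X` (viewed as the level `{speed = 1}` of the cone `c∂X`), with the metric
`W_∞` built from the cost `d_∞²`, contains no non-constant rectifiable curve. -/
theorem no_rectifiable_curve_in_boundary_measures
    (X : Type*) [MetricSpace X] [MeasurableSpace X] [BorelSpace X]
    (hX : IsHadamard X) (hvis : IsVisibility X)
    (a b : ℝ) (hab : a < b)
    (c : ℝ → {ν : Measure (Boundary X) // IsProbabilityMeasure ν})
    (hcont : ContinuousWithRespect (fun m m' => WinftyLevel1 m.1 m'.1) c (Set.Icc a b))
    (hrect : curveLengthWith (fun m m' => WinftyLevel1 m.1 m'.1) c a b < ⊤) :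
    ∀ s ∈ Set.Icc a b, ∀ t ∈ Set.Icc a b, c s = c t := by
  have key : ∀ s ∈ Set.Icc a b, ∀ t ∈ Set.Icc a b, s ≤ t → c s = c t := by
    intro s hs t ht hst
    refine Subtype.ext (Measure.ext fun A hA => ?_)
    have := (c s).2
    have := (c t).2
    have h := eq_of_four_mul_abs_sub_le_sq (fun _ _ => Real.sqrt_nonneg _) hcont hrect
      (f := fun m => m.1.real A) (fun m m' => by
        have := m.2
        have := m'.2
        exact hvis.four_mul_abs_sub_le_sq_WinftyLevel1 m.1 m'.1 hA) hs ht hst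
    exact (ENNReal.toReal_eq_toReal_iff' (measure_ne_top _ _) (measure_ne_top _ _)).1 h
  intro s hs t ht
  rcases le_total s t with hst | hst
  · exact key s hs t ht hst
  · exact (key t ht s hs hst).symm

end
end
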